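/- arXiv:1004.3376 — 2 statements merged into one kernel-verified Lean document; each statement's English description precedes it below -/
import Mathlib

section
/- Let G be a finite simple graph and suppose that in each chordless even cycle of G some vertex of the cycle has a whisker, i.e., is adjacent to a vertex of degree 1 in G. Then G is sequentially S_2 over any field k. -/
open MvPolynomial

namespace SeqSr

/-! ### Abstract simplicial complexes -/

/-- An abstract simplicial complex on the vertex set `V`, viewed as a set of finite
subsets of `V` (its faces) closed under taking subsets. -/
def IsComplex {V : Type*} (Δ : Set (Finset V)) : Prop :=
  ∀ F ∈ Δ, ∀ G : Finset V, G ⊆ F → G ∈ Δ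

/-- `Δ` is `(d-1)`-dimensional: every face has at most `d` vertices and
some face has exactly `d` vertices. -/
def HasDim {V : Type*} (Δ : Set (Finset V)) (d : ℕ) : Prop :=
  (∀ F ∈ Δ, F.card ≤ d) ∧ ∃ F ∈ Δ, F.card = d

/-- A facet is a maximal face. -/
def IsFacet {V : Type*} (Δ : Set (Finset V)) (F : Finset V) : Prop :=
  F ∈ Δ ∧ ∀ G ∈ Δ, F ⊆ G → F = G

/-- A simplicial complex is pure if all facets have the same number of vertices. -/
def IsPure {V : Type*} (Δ : Set (Finset V)) : Prop :=
  ∀ F G : Finset V, IsFacet Δ F → IsFacet Δ G → F.card = G.card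

/-- The link of a face `F` of `Δ`:
`lk_Δ F = {G : F ∩ G = ∅ and F ∪ G ∈ Δ}`. -/
def link {V : Type*} [DecidableEq V] (Δ : Set (Finset V)) (F : Finset V) :
    Set (Finset V) :=
  {G | F ∩ G = ∅ ∧ F ∪ G ∈ Δ}

/-- The `i`-skeleton of `Δ`: all faces of dimension at most `i`
(i.e. with at most `i + 1` vertices). -/
def skeleton {V : Type*} (Δ : Set (Finset V)) (i : ℕ) : Set (Finset V) :=
  {F ∈ Δ | F.card ≤ i + 1}

/-- The pure `i`-skeleton of `Δ`: the subcomplex generated by the `i`-dimensional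
faces of `Δ` (here `i : ℤ`, so that `i = -1` makes sense). -/
def pureSkeleton {V : Type*} (Δ : Set (Finset V)) (i : ℤ) : Set (Finset V) :=
  {F | ∃ G ∈ Δ, (G.card : ℤ) = i + 1 ∧ F ⊆ G}

/-- A simplicial complex is connected if any two of its vertices can be joined by a
path of `1`-dimensional faces. -/
def IsConnectedComplex {V : Type*} [DecidableEq V] (Δ : Set (Finset V)) : Prop :=
  ∀ x y : V, {x} ∈ Δ → {y} ∈ Δ →
    Relation.ReflTransGen (fun a b : V => ({a, b} : Finset V) ∈ Δ) x y

/-! ### Stanley-Reisner rings -/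

/-- The Stanley-Reisner ideal of `Δ` in the polynomial ring `k[x_v : v ∈ V]`:
the ideal generated by the squarefree monomials corresponding to non-faces of `Δ`. -/
noncomputable def srIdeal (k : Type*) [Field k] {V : Type*} (Δ : Set (Finset V)) :
    Ideal (MvPolynomial V k) :=
  Ideal.span {m | ∃ F : Finset V, F ∉ Δ ∧ m = ∏ i ∈ F, X i}

/-! ### Depth, dimension and Serre's condition for modules -/

/-- The depth of `M` with respect to the ideal `I`: the supremum of the lengths of
`M`-regular sequences consisting of elements of `I`.  (For a finitely generated
module over a Noetherian local ring, taking `I` to be the maximal ideal recovers the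
usual depth.) -/
noncomputable def depthIn (A : Type*) [CommRing A] (I : Ideal A) (M : Type*)
    [AddCommGroup M] [Module A M] : ℕ∞ :=
  sSup {n : ℕ∞ | ∃ rs : List A, (∀ x ∈ rs, x ∈ I) ∧
    RingTheory.Sequence.IsRegular M rs ∧ (rs.length : ℕ∞) = n}

/-- The (Krull) dimension of a module `M` over `A`: the Krull dimension of the ring
`A` modulo the annihilator of `M`. -/
noncomputable def mDim (A : Type*) [CommRing A] (M : Type*)
    [AddCommGroup M] [Module A M] : WithBot ℕ∞ :=
  ringKrullDim (A ⧸ Module.annihilator A M)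

/-- Serre's condition `S_r` for a module `M` over `A`: for every prime ideal `p`,
`depth M_p ≥ min (r, dim M_p)`. -/
def IsSerreMod (r : ℕ) (A : Type*) [CommRing A] (M : Type*)
    [AddCommGroup M] [Module A M] : Prop :=
  ∀ (p : Ideal A) [p.IsPrime],
    min ((r : ℕ∞) : WithBot ℕ∞)
        (mDim (Localization p.primeCompl) (LocalizedModule p.primeCompl M)) ≤
      ((depthIn (Localization p.primeCompl)
          (Ideal.map (algebraMap A (Localization p.primeCompl)) p)
          (LocalizedModule p.primeCompl M) : ℕ∞) : WithBot ℕ∞)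

/-- A module `M` over `A` is Cohen-Macaulay if `depth M_p ≥ dim M_p` for every
prime ideal `p` (the reverse inequality being automatic). -/
def IsCMMod (A : Type*) [CommRing A] (M : Type*) [AddCommGroup M] [Module A M] : Prop :=
  ∀ (p : Ideal A) [p.IsPrime],
    mDim (Localization p.primeCompl) (LocalizedModule p.primeCompl M) ≤
      ((depthIn (Localization p.primeCompl)
          (Ideal.map (algebraMap A (Localization p.primeCompl)) p)
          (LocalizedModule p.primeCompl M) : ℕ∞) : WithBot ℕ∞)

/-- `Δ` satisfies Serre's condition `S_r` over `k` if its Stanley-Reisner ring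
`k[Δ]` does, as a module over the polynomial ring. -/
def IsSerreComplex (k : Type*) [Field k] {V : Type*} (Δ : Set (Finset V)) (r : ℕ) :
    Prop :=
  IsSerreMod r (MvPolynomial V k) (MvPolynomial V k ⧸ srIdeal k Δ)

/-! ### Sequentially `S_r` and sequentially Cohen-Macaulay complexes -/

/-- A homogeneous ideal of the polynomial ring (with respect to the standard
grading): an ideal containing all homogeneous components of its elements. -/
def IsHomogeneousIdeal (k : Type*) [Field k] {V : Type*}
    (J : Ideal (MvPolynomial V k)) : Prop :=
  ∀ f ∈ J, ∀ i : ℕ, homogeneousComponent i f ∈ J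

/-- For ideals `J ⊆ J'` of `A`, the subquotient `J'/J` as an `A`-module. -/
abbrev subquot {A : Type*} [CommRing A] (J J' : Ideal A) : Type _ :=
  ↥J' ⧸ Submodule.comap J'.subtype J

/-- `Δ` is sequentially `S_r` over `k`: there is a finite filtration
`0 = M_0 ⊂ M_1 ⊂ ⋯ ⊂ M_t = k[Δ]` of `k[Δ]` by graded submodules such that each
quotient `M_i/M_{i-1}` satisfies Serre's condition `S_r` and the (Krull) dimensions
of the quotients are strictly increasing.  Since `k[Δ]` is a cyclic module generated
in degree `0`, its graded submodules are exactly the images of homogeneous ideals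
`J ⊇ I_Δ`, and `M_i/M_{i-1} = J_i/J_{i-1}`; we state the definition this way. -/
def IsSeqSerre (k : Type*) [Field k] {V : Type*} (Δ : Set (Finset V)) (r : ℕ) : Prop :=
  ∃ (t : ℕ) (J : ℕ → Ideal (MvPolynomial V k)),
    J 0 = srIdeal k Δ ∧ J t = ⊤ ∧
    (∀ i ≤ t, IsHomogeneousIdeal k (J i)) ∧
    (∀ i < t, J i < J (i + 1)) ∧
    (∀ i < t, IsSerreMod r (MvPolynomial V k) (subquot (J i) (J (i + 1)))) ∧
    (∀ i : ℕ, i + 2 ≤ t →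
      mDim (MvPolynomial V k) (subquot (J i) (J (i + 1))) <
        mDim (MvPolynomial V k) (subquot (J (i + 1)) (J (i + 2))))

/-- `Δ` is sequentially Cohen-Macaulay over `k`: there is a finite filtration
`0 = M_0 ⊂ M_1 ⊂ ⋯ ⊂ M_t = k[Δ]` by graded submodules with Cohen-Macaulay
quotients of strictly increasing dimensions. -/
def IsSeqCM (k : Type*) [Field k] {V : Type*} (Δ : Set (Finset V)) : Prop :=
  ∃ (t : ℕ) (J : ℕ → Ideal (MvPolynomial V k)),
    J 0 = srIdeal k Δ ∧ J t = ⊤ ∧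
    (∀ i ≤ t, IsHomogeneousIdeal k (J i)) ∧
    (∀ i < t, J i < J (i + 1)) ∧
    (∀ i < t, IsCMMod (MvPolynomial V k) (subquot (J i) (J (i + 1)))) ∧
    (∀ i : ℕ, i + 2 ≤ t →
      mDim (MvPolynomial V k) (subquot (J i) (J (i + 1))) <
        mDim (MvPolynomial V k) (subquot (J (i + 1)) (J (i + 2))))

/-! ### Graphs -/

/-- The independence complex of a graph `G`: faces are the independent sets. -/
def indepComplex {V : Type*} (G : SimpleGraph V) : Set (Finset V) :=
  {F | ∀ x ∈ F, ∀ y ∈ F, ¬ G.Adj x y}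

/-! ### Chordless cycles -/

/-- `p 0, …, p (m - 1)` are the consecutive vertices of a cycle of `G` inside `S`. -/
def IsCycleSeq {V : Type*} (G : SimpleGraph V) (S : Set V) (m : ℕ) (p : ℕ → V) : Prop :=
  3 ≤ m ∧ (∀ a < m, p a ∈ S) ∧ (∀ a < m, ∀ b < m, p a = p b → a = b) ∧
    (∀ a, a + 1 < m → G.Adj (p a) (p (a + 1))) ∧ G.Adj (p (m - 1)) (p 0)

lemma exists_isCycleSeq {V : Type*} [Finite V] (G : SimpleGraph V) {S : Set V}
    (hne : S.Nonempty) (hdeg : ∀ v ∈ S, ∀ u, ∃ w ∈ S, G.Adj v w ∧ w ≠ u) :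
    ∃ m p, IsCycleSeq G S m p := by
  classical
  obtain ⟨v₀, hv₀⟩ := hne
  choose! nxt hS hadj hback using hdeg
  -- a walk in `S` that never turns back
  let q : ℕ → V × V := fun n => (fun e : V × V => (e.2, nxt e.2 e.1))^[n] (v₀, v₀)
  have hq : ∀ n, q (n + 1) = ((q n).2, nxt (q n).2 (q n).1) := fun n => by
    simp only [q, Function.iterate_succ_apply']
  let p : ℕ → V := fun n => (q n).2
  have hpS : ∀ n, p n ∈ S := by
    intro n
    induction n with
    | zero => exact hv₀
    | succ n ih => simp only [p, hq]; exact hS _ ih _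
  have hpadj : ∀ n, G.Adj (p n) (p (n + 1)) := by
    intro n
    have := hadj _ (hpS n) (q n).1
    simpa only [p, hq] using this
  have hpback : ∀ n, p (n + 2) ≠ p n := by
    intro n
    have := hback _ (hpS (n + 1)) (q (n + 1)).1
    simpa only [p, hq] using this
  have hrep : ∃ d, 0 < d ∧ ∃ i, p i = p (i + d) := by
    obtain ⟨i, j, hij, he⟩ := Finite.exists_ne_map_eq_of_infinite p
    rcases lt_or_gt_of_ne hij with h | h
    · exact ⟨j - i, by omega, i, by rw [he]; congr 1; omega⟩
    · exact ⟨i - j, by omega, j, by rw [← he]; congr 1; omega⟩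
  obtain ⟨hd, i, hi⟩ := Nat.find_spec hrep
  set d := Nat.find hrep with hddef
  have hmin : ∀ e, 0 < e → e < d → ∀ a, p a ≠ p (a + e) := fun e he hlt a h =>
    Nat.find_min hrep hlt ⟨he, a, h⟩
  refine ⟨d, fun a => p (i + a), ?_, fun a _ => hpS _, ?_, fun a _ => hpadj _, ?_⟩
  · by_contra hlt
    interval_cases h : d
    · exact (hpadj i).ne hi
    · exact hpback i hi.symm
  · have key : ∀ a b, a < b → b < d → p (i + a) ≠ p (i + b) := fun a b hab hb h =>
      hmin (b - a) (by omega) (by omega) (i + a) (by rw [h]; congr 1; omega)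
    intro a ha b hb h
    rcases lt_trichotomy a b with hab | hab | hab
    · exact (key a b hab hb h).elim
    · exact hab
    · exact (key b a hab ha h.symm).elim
  · have := hpadj (i + (d - 1))
    rwa [show i + (d - 1) + 1 = i + d by omega, ← hi] at this

lemma exists_chordless_isCycleSeq {V : Type*} (G : SimpleGraph V) {S : Set V}
    (h : ∃ m p, IsCycleSeq G S m p) :
    ∃ m p, IsCycleSeq G S m p ∧
      ∀ a b, a < b → b < m → G.Adj (p a) (p b) → b = a + 1 ∨ (a = 0 ∧ b + 1 = m) := by
  classical
  obtain ⟨p, hm, hS, hinj, hadj, hlast⟩ := Nat.find_spec h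
  set m := Nat.find h
  refine ⟨m, p, ⟨hm, hS, hinj, hadj, hlast⟩, fun a b hab hb hchord => ?_⟩
  by_contra hcon
  refine Nat.find_min h (m := b - a + 1) (by omega) ⟨fun c => p (a + c), by omega,
    fun c hc => hS _ (by omega), fun c hc e he hce => ?_, fun c hc => hadj _ (by omega), ?_⟩
  · have := hinj _ (by omega) _ (by omega) hce
    omega
  · simpa [show a + (b - a) = b by omega] using hchord.symm

lemma IsCycleSeq.exists_zmod {V : Type*} {G : SimpleGraph V} {S : Set V} {m : ℕ} {p : ℕ → V}
    (hp : IsCycleSeq G S m p)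
    (hchord : ∀ a b, a < b → b < m → G.Adj (p a) (p b) → b = a + 1 ∨ (a = 0 ∧ b + 1 = m)) :
    ∃ f : ZMod m → V, Function.Injective f ∧ (∀ i, f i ∈ S) ∧
      ∀ i j : ZMod m, G.Adj (f i) (f j) ↔ (j = i + 1 ∨ i = j + 1) := by
  obtain ⟨hm, hS, hinj, hadj, hlast⟩ := hp
  have : NeZero m := ⟨by omega⟩
  have hsucc : ∀ i j : ZMod m, j = i + 1 ↔
      (j.val = i.val + 1 ∨ (j.val = 0 ∧ i.val + 1 = m)) := by
    intro i j
    have hi := i.val_lt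
    have hj := j.val_lt
    have h1 : (1 : ZMod m).val = 1 := ZMod.val_one'' (by omega)
    rw [← (ZMod.val_injective m).eq_iff, ZMod.val_add, h1]
    rcases Nat.lt_or_ge (i.val + 1) m with h | h
    · rw [Nat.mod_eq_of_lt h]; omega
    · rw [show i.val + 1 = m by omega, Nat.mod_self]; omega
  have key : ∀ a b, a < b → b < m →
      (G.Adj (p a) (p b) ↔ (b = a + 1 ∨ (a = 0 ∧ b + 1 = m))) := by
    refine fun a b hab hb => ⟨hchord a b hab hb, ?_⟩
    rintro (rfl | ⟨rfl, h⟩)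
    · exact hadj a hb
    · rw [show b = m - 1 by omega]; exact hlast.symm
  refine ⟨fun i => p i.val, fun i j hij => ZMod.val_injective m
    (hinj _ i.val_lt _ j.val_lt hij), fun i => hS _ i.val_lt, fun i j => ?_⟩
  have hi := i.val_lt
  have hj := j.val_lt
  rw [hsucc i j, hsucc j i]
  rcases lt_trichotomy i.val j.val with h | h | h
  · rw [key _ _ h hj]; omega
  · simp only [h, SimpleGraph.irrefl, false_iff]; omega
  · rw [G.adj_comm, key _ _ h hi]; omega

lemma IsCycleSeq.even_of_bipartite {V : Type*} {G : SimpleGraph V} {S : Set V} {m : ℕ}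
    {p : ℕ → V} (hp : IsCycleSeq G S m p) {c : V → Prop}
    (hc : ∀ x ∈ S, ∀ y ∈ S, G.Adj x y → (c x ↔ ¬ c y)) : Even m := by
  obtain ⟨hm, hS, -, hadj, hlast⟩ := hp
  have hpar : ∀ a < m, (c (p a) ↔ (c (p 0) ↔ Even a)) := by
    intro a
    induction a with
    | zero => simp
    | succ a ih =>
      intro ha
      have h1 := ih (by omega)
      have h2 := hc _ (hS a (by omega)) _ (hS _ ha) (hadj a ha)
      rw [Nat.even_add_one]
      tauto
  have h1 := hpar (m - 1) (by omega)
  have h2 := hc _ (hS _ (by omega)) _ (hS 0 (by omega)) hlast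
  have h3 : Even m ↔ ¬ Even (m - 1) := by
    conv_lhs => rw [show m = m - 1 + 1 by omega]
    exact Nat.even_add_one
  tauto

/-! ### Strong connectivity of the pure skeleta of the stars -/

/-- Two `d`-element independent sets containing `W` are joined by a chain of such sets, in
which consecutive sets differ in at most one vertex. -/
def IndepChain {V : Type*} [DecidableEq V] (G : SimpleGraph V) (W : Finset V) (d : ℕ) :
    Finset V → Finset V → Prop :=
  Relation.ReflTransGen fun K L => (K ∈ indepComplex G ∧ K.card = d ∧ W ⊆ K) ∧
    (L ∈ indepComplex G ∧ L.card = d ∧ W ⊆ L) ∧ d ≤ (K ∩ L).card + 1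

section Chain

variable {V : Type*} [DecidableEq V] {G : SimpleGraph V} {d : ℕ}

lemma IndepChain.mono {W W' A B : Finset V} (hW : W ⊆ W') (h : IndepChain G W' d A B) :
    IndepChain G W d A B :=
  Relation.ReflTransGen.lift id (fun _ _ ⟨⟨h1, h2, h3⟩, ⟨h4, h5, h6⟩, h7⟩ =>
    ⟨⟨h1, h2, hW.trans h3⟩, ⟨h4, h5, hW.trans h6⟩, h7⟩) _ _ h

lemma IndepChain.symm {W A B : Finset V} (h : IndepChain G W d A B) : IndepChain G W d B A :=
  Relation.reflTransGen_swap.1 (Relation.ReflTransGen.lift id (fun _ _ ⟨h1, h2, h3⟩ =>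
    ⟨h2, h1, by rwa [Finset.inter_comm]⟩) _ _ h)

lemma insert_erase_mem_indepComplex {B : Finset V} (hB : B ∈ indepComplex G) {v b : V}
    (hv : ∀ w ∈ B, G.Adj v w → w = b) : insert v (B.erase b) ∈ indepComplex G := by
  intro x hx y hy hxy
  simp only [Finset.mem_insert, Finset.mem_erase] at hx hy
  rcases hx with rfl | ⟨hxb, hx⟩ <;> rcases hy with rfl | ⟨hyb, hy⟩
  · exact hxy.ne rfl
  · exact hyb (hv y hy hxy)
  · exact hxb (hv x hx hxy.symm)
  · exact hB x hx y hy hxy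

lemma card_insert_erase {B : Finset V} {v b : V} (hv : v ∉ B) (hb : b ∈ B) :
    (insert v (B.erase b)).card = B.card := by
  rw [Finset.card_insert_of_notMem (fun h => hv (Finset.mem_of_mem_erase h)),
    Finset.card_erase_add_one hb]

lemma IndepChain.insert_erase {B W : Finset V} (hB : B ∈ indepComplex G) (hBd : B.card = d)
    {v b : V} (hv : ∀ w ∈ B, G.Adj v w → w = b) (hvB : v ∉ B) (hb : b ∈ B)
    (hW : W ⊆ B) (hbW : b ∉ W) : IndepChain G W d B (insert v (B.erase b)) := by
  refine Relation.ReflTransGen.single ⟨⟨hB, hBd, hW⟩,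
    ⟨insert_erase_mem_indepComplex hB hv, by rw [card_insert_erase hvB hb, hBd], ?_⟩, ?_⟩
  · exact (Finset.subset_erase.2 ⟨hW, hbW⟩).trans (Finset.subset_insert _ _)
  · have h1 : B.erase b ⊆ B ∩ insert v (B.erase b) :=
      Finset.subset_inter (Finset.erase_subset _ _) (Finset.subset_insert _ _)
    have h2 := Finset.card_le_card h1
    have h3 := Finset.card_erase_add_one hb
    omega

/-- If some vertex of `A \ B` has at most one neighbour in `B`, then `A` can be joined to `B`
through an exchange, provided closer sets can be joined. -/
lemma IndepChain.of_exchange {A B : Finset V}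
    (ih : ∀ A' B', A' ∈ indepComplex G → B' ∈ indepComplex G → A'.card = d → B'.card = d →
      (A' \ B').card < (A \ B).card → IndepChain G (A' ∩ B') d A' B')
    (hA : A ∈ indepComplex G) (hB : B ∈ indepComplex G) (hAd : A.card = d) (hBd : B.card = d)
    {v b : V} (hvA : v ∈ A) (hvB : v ∉ B) (hbB : b ∈ B) (hbA : b ∉ A)
    (hv : ∀ w ∈ B, G.Adj v w → w = b) : IndepChain G (A ∩ B) d A B := by
  have hsub : A \ insert v (B.erase b) ⊂ A \ B := by
    refine Finset.ssubset_iff_subset_ne.2 ⟨?_, fun h => ?_⟩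
    · intro x hx
      simp only [Finset.mem_sdiff, Finset.mem_insert, Finset.mem_erase] at hx ⊢
      refine ⟨hx.1, fun hxB => hx.2 (Or.inr ⟨?_, hxB⟩)⟩
      rintro rfl
      exact hbA hx.1
    · have : v ∈ A \ insert v (B.erase b) := by rw [h]; simp [hvA, hvB]
      simp at this
  have h1 := ih A (insert v (B.erase b)) hA (insert_erase_mem_indepComplex hB hv) hAd
    (by rw [card_insert_erase hvB hbB, hBd]) (Finset.card_lt_card hsub)
  have h2 : IndepChain G (A ∩ B) d B (insert v (B.erase b)) :=
    IndepChain.insert_erase hB hBd hv hvB hbB Finset.inter_subset_right (by simp [hbA])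
  refine (h1.mono ?_).trans h2.symm
  refine Finset.subset_inter Finset.inter_subset_left fun x hx => ?_
  simp only [Finset.mem_inter, Finset.mem_insert, Finset.mem_erase] at hx ⊢
  refine Or.inr ⟨?_, hx.2⟩
  rintro rfl
  exact hbA hx.1

/-- If a vertex of `A \ B` has a whisker outside `A ∪ B`, then `A` can be joined to `B`,
provided closer sets can be joined. -/
lemma IndepChain.of_whisker {A B : Finset V}
    (ih : ∀ A' B', A' ∈ indepComplex G → B' ∈ indepComplex G → A'.card = d → B'.card = d →
      (A' \ B').card < (A \ B).card → IndepChain G (A' ∩ B') d A' B')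
    (hA : A ∈ indepComplex G) (hB : B ∈ indepComplex G) (hAd : A.card = d) (hBd : B.card = d)
    {x z b : V} (hxA : x ∈ A) (hxB : x ∉ B) (hbB : b ∈ B) (hbA : b ∉ A)
    (hzA : z ∉ A) (hzB : z ∉ B) (hz : ∀ u, G.Adj z u → u = x) :
    IndepChain G (A ∩ B) d A B := by
  have hv : ∀ w ∈ A, G.Adj z w → w = x := fun w _ h => hz w h
  have h1 : IndepChain G (A ∩ B) d A (insert z (A.erase x)) :=
    IndepChain.insert_erase hA hAd hv hzA hxA Finset.inter_subset_left (by simp [hxB])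
  have hcard : (insert z (A.erase x) \ B).card = (A \ B).card := by
    have : insert z (A.erase x) \ B = insert z ((A \ B).erase x) := by
      ext y
      simp only [Finset.mem_sdiff, Finset.mem_insert, Finset.mem_erase]
      constructor
      · tauto
      · rintro (rfl | h)
        · exact ⟨Or.inl rfl, hzB⟩
        · tauto
    rw [this, card_insert_erase (by simp [hzA]) (by simp [hxA, hxB])]
  have hbz : b ≠ z := by rintro rfl; exact hzB hbB
  have h2 : IndepChain G (insert z (A.erase x) ∩ B) d (insert z (A.erase x)) B := by
    refine IndepChain.of_exchange (fun A' B' h1 h2 h3 h4 h5 => ih A' B' h1 h2 h3 h4 (hcard ▸ h5))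
      (insert_erase_mem_indepComplex hA hv) hB
      (by rw [card_insert_erase hzA hxA, hAd]) hBd (Finset.mem_insert_self _ _) hzB hbB
      (by simp [hbA, hbz]) ?_
    intro w hw hzw
    exact absurd (hz w hzw ▸ hw) hxB
  refine h1.trans (h2.mono ?_)
  intro y hy
  simp only [Finset.mem_inter, Finset.mem_insert, Finset.mem_erase] at hy ⊢
  refine ⟨Or.inr ⟨?_, hy.1⟩, hy.2⟩
  rintro rfl
  exact hxB hy.2

end Chain

theorem indepChain_of_whiskered {V : Type*} [Fintype V] [DecidableEq V] {G : SimpleGraph V}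
    (h : ∀ m : ℕ, Even m → 3 ≤ m → ∀ f : ZMod m → V, Function.Injective f →
      (∀ i j : ZMod m, G.Adj (f i) (f j) ↔ (j = i + 1 ∨ i = j + 1)) →
      ∃ (i : ZMod m) (z : V), G.Adj (f i) z ∧ ∀ u : V, G.Adj z u → u = f i)
    (d : ℕ) (A B : Finset V) (hA : A ∈ indepComplex G) (hB : B ∈ indepComplex G)
    (hAd : A.card = d) (hBd : B.card = d) : IndepChain G (A ∩ B) d A B := by
  induction hs : (A \ B).card using Nat.strong_induction_on generalizing A B with
  | _ s ih =>
  subst hs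
  have hcomm : (B \ A).card = (A \ B).card := by
    have h1 := Finset.card_sdiff_add_card_inter A B
    have h2 := Finset.card_sdiff_add_card_inter B A
    rw [Finset.inter_comm] at h2
    omega
  have ih' : ∀ A' B', A' ∈ indepComplex G → B' ∈ indepComplex G → A'.card = d → B'.card = d →
      (A' \ B').card < (A \ B).card → IndepChain G (A' ∩ B') d A' B' :=
    fun A' B' h1 h2 h3 h4 h5 => ih _ h5 A' B' h1 h2 h3 h4 rfl
  have ih'' : ∀ A' B', A' ∈ indepComplex G → B' ∈ indepComplex G → A'.card = d → B'.card = d →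
      (A' \ B').card < (B \ A).card → IndepChain G (A' ∩ B') d A' B' := by rwa [hcomm]
  rcases Nat.eq_zero_or_pos (A \ B).card with hs | hs
  · refine Relation.ReflTransGen.single ⟨⟨hA, hAd, Finset.inter_subset_left⟩,
      ⟨hB, hBd, Finset.inter_subset_right⟩, ?_⟩
    have := Finset.card_sdiff_add_card_inter A B
    omega
  obtain ⟨a₀, ha₀⟩ := Finset.card_pos.1 hs
  obtain ⟨b₀, hb₀⟩ := Finset.card_pos.1 (hcomm ▸ hs)
  rw [Finset.mem_sdiff] at ha₀ hb₀
  by_cases hexA : ∃ v ∈ A \ B, ∃ b ∈ B \ A, ∀ w ∈ B, G.Adj v w → w = b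
  · obtain ⟨v, hv, b, hb, hvb⟩ := hexA
    rw [Finset.mem_sdiff] at hv hb
    exact IndepChain.of_exchange ih' hA hB hAd hBd hv.1 hv.2 hb.1 hb.2 hvb
  by_cases hexB : ∃ v ∈ B \ A, ∃ b ∈ A \ B, ∀ w ∈ A, G.Adj v w → w = b
  · obtain ⟨v, hv, b, hb, hvb⟩ := hexB
    rw [Finset.mem_sdiff] at hv hb
    have := IndepChain.of_exchange ih'' hB hA hBd hAd hv.1 hv.2 hb.1 hb.2 hvb
    rw [Finset.inter_comm]
    exact this.symm
  push Not at hexA hexB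
  -- every vertex of the bipartite graph on `A ∆ B` has at least two neighbours
  have two : ∀ A B : Finset V, A ∈ indepComplex G → (B \ A).Nonempty →
      (∀ v ∈ A \ B, ∀ b ∈ B \ A, ∃ w ∈ B, G.Adj v w ∧ w ≠ b) →
      ∀ v ∈ A \ B, ∀ u, ∃ w ∈ B \ A, G.Adj v w ∧ w ≠ u := by
    intro A B hA hne hex v hv u
    have hvA := (Finset.mem_sdiff.1 hv).1
    obtain ⟨b, hb⟩ := hne
    by_cases hu : u ∈ B \ A
    · obtain ⟨w, hw, hvw, hwu⟩ := hex v hv u hu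
      exact ⟨w, Finset.mem_sdiff.2 ⟨hw, fun hwA => hA v hvA w hwA hvw⟩, hvw, hwu⟩
    · obtain ⟨w, hw, hvw, -⟩ := hex v hv b hb
      have hw' := Finset.mem_sdiff.2 ⟨hw, fun hwA => hA v hvA w hwA hvw⟩
      exact ⟨w, hw', hvw, by rintro rfl; exact hu hw'⟩
  have twoA := two A B hA ⟨b₀, Finset.mem_sdiff.2 hb₀⟩ hexA
  have twoB := two B A hB ⟨a₀, Finset.mem_sdiff.2 ha₀⟩ hexB
  let S : Set V := {v | v ∈ A \ B ∨ v ∈ B \ A}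
  have hdeg : ∀ v ∈ S, ∀ u, ∃ w ∈ S, G.Adj v w ∧ w ≠ u := by
    rintro v (hv | hv) u
    · obtain ⟨w, hw, h⟩ := twoA v hv u
      exact ⟨w, Or.inr hw, h⟩
    · obtain ⟨w, hw, h⟩ := twoB v hv u
      exact ⟨w, Or.inl hw, h⟩
  obtain ⟨m, p, hp, hchord⟩ := exists_chordless_isCycleSeq G
    (exists_isCycleSeq G ⟨a₀, Or.inl (Finset.mem_sdiff.2 ha₀)⟩ hdeg)
  have heven : Even m := by
    refine hp.even_of_bipartite (c := fun v => v ∈ A) ?_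
    intro x hx y hy hxy
    have h1 : ¬ (x ∈ A ∧ y ∈ A) := fun h => hA x h.1 y h.2 hxy
    have h2 : ¬ (x ∈ B ∧ y ∈ B) := fun h => hB x h.1 y h.2 hxy
    simp only [S, Set.mem_ofPred_eq, Finset.mem_sdiff] at hx hy
    tauto
  obtain ⟨f, hinj, hfS, hf⟩ := hp.exists_zmod hchord
  obtain ⟨i, z, hiz, hz⟩ := h m heven hp.1 f hinj hf
  have hzS : z ∉ S := by
    intro hzS
    obtain ⟨w, -, hzw, hne⟩ := hdeg z hzS (f i)
    exact hne (hz w hzw)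
  have hzAB : z ∉ A ∧ z ∉ B := by
    have h1 : ¬ (f i ∈ A ∧ z ∈ A) := fun h => hA _ h.1 _ h.2 hiz
    have h2 : ¬ (f i ∈ B ∧ z ∈ B) := fun h => hB _ h.1 _ h.2 hiz
    have h3 := hfS i
    simp only [S, Set.mem_ofPred_eq, Finset.mem_sdiff] at hzS h3
    tauto
  rcases hfS i with hi | hi
  · rw [Finset.mem_sdiff] at hi
    exact IndepChain.of_whisker ih' hA hB hAd hBd hi.1 hi.2 hb₀.1 hb₀.2 hzAB.1 hzAB.2 hz
  · rw [Finset.mem_sdiff] at hi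
    rw [Finset.inter_comm]
    exact (IndepChain.of_whisker ih'' hB hA hBd hAd hi.1 hi.2 ha₀.1 ha₀.2 hzAB.2 hzAB.1 hz).symm

/-! ### Coordinate projections of the polynomial ring -/

section Projection

variable (k : Type*) [Field k] {V : Type*}

/-- The quotient map `k[x_v : v ∈ V] → k[x_v : v ∈ K]` killing the variables outside `K`. -/
noncomputable def restr (K : Finset V) : MvPolynomial V k →ₐ[k] MvPolynomial K k :=
  killCompl (f := ((↑) : K → V)) Subtype.val_injective

/-- The endomorphism of `k[x_v : v ∈ V]` killing the variables outside `K`. -/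
noncomputable def proj (K : Finset V) : MvPolynomial V k →ₐ[k] MvPolynomial V k :=
  (rename (Subtype.val : K → V)).comp (restr k K)

/-- The prime ideal generated by the variables outside `K`. -/
noncomputable def varIdeal (K : Finset V) : Ideal (MvPolynomial V k) :=
  RingHom.ker (restr k K)

instance (K : Finset V) : (varIdeal k K).IsPrime := RingHom.ker_isPrime _

lemma restr_rename (K : Finset V) (f : MvPolynomial K k) :
    restr k K (rename Subtype.val f) = f :=
  killCompl_rename_app _ f

lemma restr_surjective (K : Finset V) : Function.Surjective (restr k K) :=
  fun f => ⟨_, restr_rename k K f⟩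

lemma coeff_proj (K : Finset V) (f : MvPolynomial V k) (a : V →₀ ℕ) [Decidable (a.support ⊆ K)] :
    coeff a (proj k K f) = if a.support ⊆ K then coeff a f else 0 := by
  split_ifs with h
  · have ha : (a.comapDomain Subtype.val (Subtype.val_injective.injOn)).mapDomain
        (Subtype.val : K → V) = a :=
      Finsupp.mapDomain_comapDomain _ Subtype.val_injective _ (by simpa using h)
    rw [← ha]
    simp only [proj, AlgHom.comp_apply]
    rw [coeff_rename_mapDomain _ Subtype.val_injective, restr, coeff_killCompl]
  · by_contra hne
    obtain ⟨b, hb, -⟩ := coeff_rename_ne_zero _ _ _ hne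
    refine h fun v hv => ?_
    rw [← hb] at hv
    classical
    obtain ⟨w, -, rfl⟩ := Finset.mem_image.1 (Finsupp.mapDomain_support hv)
    exact w.2

variable {k}

lemma proj_eq_zero_iff_restr {K : Finset V} {f : MvPolynomial V k} :
    proj k K f = 0 ↔ restr k K f = 0 :=
  map_eq_zero_iff _ (rename_injective _ Subtype.val_injective)

lemma mem_varIdeal {K : Finset V} {f : MvPolynomial V k} :
    f ∈ varIdeal k K ↔ proj k K f = 0 := by
  rw [proj_eq_zero_iff_restr]; rfl

lemma proj_eq_zero_iff {K : Finset V} {f : MvPolynomial V k} :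
    proj k K f = 0 ↔ ∀ a ∈ f.support, ¬ a.support ⊆ K := by
  classical
  simp only [MvPolynomial.ext_iff, coeff_proj, coeff_zero, mem_support_iff]
  refine forall_congr' fun a => ?_
  split_ifs with h <;> simp [h]

lemma proj_proj [DecidableEq V] (K L : Finset V) (f : MvPolynomial V k) :
    proj k K (proj k L f) = proj k (K ∩ L) f := by
  ext a
  simp only [coeff_proj, Finset.subset_inter_iff]
  split_ifs <;> tauto

lemma proj_proj_of_subset {K L : Finset V} (h : K ⊆ L) (f : MvPolynomial V k) :
    proj k K (proj k L f) = proj k K f := by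
  classical
  rw [proj_proj, Finset.inter_eq_left.2 h]

lemma varIdeal_anti {K L : Finset V} (h : K ⊆ L) : varIdeal k L ≤ varIdeal k K := by
  intro f hf
  rw [mem_varIdeal] at hf ⊢
  rw [← proj_proj_of_subset h, hf, map_zero]

lemma varIdeal_eq_span (K : Finset V) :
    varIdeal k K = Ideal.span (X '' {v | v ∉ K}) := by
  ext f
  rw [mem_varIdeal, proj_eq_zero_iff, mem_ideal_span_X_image]
  simp only [Finset.subset_iff, Finsupp.mem_support_iff, Set.mem_ofPred_eq]
  push Not
  simp [and_comm]

lemma X_mem_varIdeal {K : Finset V} {v : V} : X v ∈ varIdeal k K ↔ v ∉ K := by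
  classical
  rw [mem_varIdeal, proj_eq_zero_iff, support_X]
  simp

lemma sub_rename_restr_mem (K : Finset V) (f : MvPolynomial V k) :
    f - rename Subtype.val (restr k K f) ∈ varIdeal k K := by
  simp [varIdeal, RingHom.mem_ker, restr_rename]

variable [Fintype V]

lemma height_varIdeal_sup_le (K : Finset V) (q : MvPolynomial V k)
    (h : varIdeal k K ⊔ Ideal.span {q} ≠ ⊤) :
    (varIdeal k K ⊔ Ideal.span {q}).height + K.card ≤ Fintype.card V + 1 := by
  classical
  have hspan : varIdeal k K ⊔ Ideal.span {q} =
      Ideal.span ((insert q (Finset.image X Kᶜ) : Finset (MvPolynomial V k)) : Set _) := by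
    rw [varIdeal_eq_span, ← Ideal.span_union, Finset.coe_insert, Set.insert_eq, Set.union_comm]
    congr 2
    ext; simp
  have h1 := Ideal.height_le_spanFinrank _ h
  have h2 : (varIdeal k K ⊔ Ideal.span {q}).spanFinrank ≤ Fintype.card V - K.card + 1 := by
    rw [hspan]
    refine (Submodule.spanFinrank_span_le_ncard_of_finite (Finset.finite_toSet _)).trans ?_
    rw [Set.ncard_coe_finset]
    refine (Finset.card_insert_le _ _).trans ?_
    have := Finset.card_image_le (s := Kᶜ) (f := (X : V → MvPolynomial V k))
    rw [Finset.card_compl] at this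
    omega
  have h3 := K.card_le_univ
  calc _ ≤ ((Fintype.card V - K.card + 1 : ℕ) : ℕ∞) + K.card := by
        gcongr; exact h1.trans (by exact_mod_cast h2)
    _ ≤ _ := by norm_cast; omega

lemma height_varIdeal_le (K : Finset V) :
    (varIdeal k K).height + K.card ≤ Fintype.card V := by
  classical
  have hspan : varIdeal k K =
      Ideal.span ((Finset.image X Kᶜ : Finset (MvPolynomial V k)) : Set _) := by
    rw [varIdeal_eq_span]
    congr 1
    ext; simp
  have h1 := Ideal.height_le_spanFinrank (varIdeal k K) Ideal.IsPrime.ne_top'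
  have h2 : (varIdeal k K).spanFinrank ≤ Fintype.card V - K.card := by
    rw [hspan]
    refine (Submodule.spanFinrank_span_le_ncard_of_finite (Finset.finite_toSet _)).trans ?_
    rw [Set.ncard_coe_finset]
    have := Finset.card_image_le (s := Kᶜ) (f := (X : V → MvPolynomial V k))
    rwa [Finset.card_compl] at this
  have h3 := K.card_le_univ
  calc _ ≤ ((Fintype.card V - K.card : ℕ) : ℕ∞) + K.card := by
        gcongr; exact h1.trans (by exact_mod_cast h2)
    _ ≤ _ := by norm_cast; omega

lemma le_height_varIdeal (K : Finset V) :
    (Fintype.card V : ℕ∞) ≤ (varIdeal k K).height + K.card := by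
  classical
  induction hn : Fintype.card V - K.card generalizing K with
  | zero =>
    have h : Fintype.card V ≤ K.card := by omega
    exact le_add_left (by exact_mod_cast h)
  | succ n ih =>
    obtain ⟨v, hv⟩ : ∃ v, v ∉ K := by
      by_contra! h
      rw [Finset.eq_univ_of_forall h, Finset.card_univ] at hn
      omega
    have hcard := Finset.card_insert_of_notMem hv
    have hlt : varIdeal k (insert v K) < varIdeal k K := by
      refine lt_of_le_of_ne (varIdeal_anti (Finset.subset_insert _ _)) fun h => ?_
      have h1 : (X v : MvPolynomial V k) ∈ varIdeal k K := X_mem_varIdeal.2 hv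
      rw [← h, X_mem_varIdeal] at h1
      simp at h1
    refine (ih (insert v K) (by omega)).trans ?_
    rw [hcard, Nat.cast_add, add_comm (K.card : ℕ∞), ← add_assoc]
    gcongr
    exact_mod_cast Ideal.height_add_one_le_of_lt_of_isPrime hlt

lemma ringKrullDim_quotient_varIdeal (K : Finset V) :
    ringKrullDim (MvPolynomial V k ⧸ varIdeal k K) = K.card := by
  refine (ringKrullDim_eq_of_ringEquiv (RingHom.quotientKerEquivOfSurjective
    (f := (restr k K).toRingHom) (restr_surjective k K))).trans ?_
  simp

end Projection

/-! ### Face ideals -/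

section FaceIdeal

variable {k : Type*} [Field k] {V : Type*}

lemma mem_srIdeal {Δ : Set (Finset V)} (hΔ : IsComplex Δ) {f : MvPolynomial V k} :
    f ∈ srIdeal k Δ ↔ ∀ a ∈ f.support, a.support ∉ Δ := by
  classical
  have hset : {m : MvPolynomial V k | ∃ F : Finset V, F ∉ Δ ∧ m = ∏ i ∈ F, X i} =
      (fun s => monomial s (1 : k)) '' {s | ∃ F : Finset V, F ∉ Δ ∧
      s = Finsupp.indicator F fun _ _ => 1} := by
    ext m
    have hm : ∀ F : Finset V, ∏ i ∈ F, (X i : MvPolynomial V k) =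
        monomial (Finsupp.indicator F fun _ _ => 1) 1 := by
      intro F
      simp only [X]
      rw [← monomial_sum_one]
      congr 2
      ext v
      simp [Finsupp.finsetSum_apply, Finsupp.indicator_apply, Finsupp.single_apply]
    constructor
    · rintro ⟨F, hF, rfl⟩
      exact ⟨_, ⟨F, hF, rfl⟩, (hm F).symm⟩
    · rintro ⟨_, ⟨F, hF, rfl⟩, rfl⟩
      exact ⟨F, hF, (hm F).symm⟩
  rw [srIdeal, hset, mem_ideal_span_monomial_image]
  refine forall₂_congr fun a _ => ?_
  constructor
  · rintro ⟨_, ⟨F, hF, rfl⟩, hle⟩ ha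
    refine hF (hΔ _ ha F fun v hv => ?_)
    have := hle v
    simp only [Finsupp.indicator_apply, hv, dif_pos] at this
    rw [Finsupp.mem_support_iff]
    omega
  · refine fun ha => ⟨_, ⟨a.support, ha, rfl⟩, fun v => ?_⟩
    simp only [Finsupp.indicator_apply]
    split_ifs with hv
    · exact Nat.one_le_iff_ne_zero.2 (Finsupp.mem_support_iff.1 hv)
    · exact Nat.zero_le _

lemma IsComplex.isHomogeneousIdeal_srIdeal {Δ : Set (Finset V)} (hΔ : IsComplex Δ) :
    IsHomogeneousIdeal k (srIdeal k Δ) := by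
  classical
  intro f hf i
  rw [mem_srIdeal hΔ] at hf ⊢
  intro a ha
  refine hf a ?_
  rw [mem_support_iff, coeff_homogeneousComponent] at ha
  rw [mem_support_iff]
  intro h
  simp [h] at ha

/-- The subcomplex of `Δ` generated by the faces with at least `d` vertices. -/
def upper (Δ : Set (Finset V)) (d : ℕ) : Set (Finset V) :=
  {W | ∃ K ∈ Δ, d ≤ K.card ∧ W ⊆ K}

lemma isComplex_upper (Δ : Set (Finset V)) (d : ℕ) : IsComplex (upper Δ d) :=
  fun _ ⟨K, hK, hd, h⟩ _ hG => ⟨K, hK, hd, hG.trans h⟩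

lemma IsComplex.upper_zero {Δ : Set (Finset V)} (hΔ : IsComplex Δ) : upper Δ 0 = Δ := by
  ext W
  exact ⟨fun ⟨K, hK, _, h⟩ => hΔ K hK W h, fun h => ⟨W, h, Nat.zero_le _, Finset.Subset.rfl⟩⟩

lemma upper_card_succ [Fintype V] (Δ : Set (Finset V)) :
    upper Δ (Fintype.card V + 1) = ∅ := by
  refine Set.eq_empty_of_forall_notMem fun W ⟨K, _, h, _⟩ => ?_
  have := K.card_le_univ
  omega

lemma srIdeal_empty : srIdeal k (∅ : Set (Finset V)) = ⊤ :=
  (Ideal.eq_top_iff_one _).2 (Ideal.subset_span ⟨∅, by simp, by simp⟩)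

lemma mem_srIdeal_upper {Δ : Set (Finset V)} {d : ℕ} {f : MvPolynomial V k} :
    f ∈ srIdeal k (upper Δ d) ↔ ∀ K ∈ Δ, d ≤ K.card → proj k K f = 0 := by
  rw [mem_srIdeal (isComplex_upper Δ d)]
  simp only [proj_eq_zero_iff]
  exact ⟨fun h K hK hd a ha hs => h a ha ⟨K, hK, hd, hs⟩,
    fun h a ha ⟨K, hK, hd, hs⟩ => h K hK hd a ha hs⟩

lemma mem_srIdeal_upper_iff {Δ : Set (Finset V)} {d : ℕ} {f : MvPolynomial V k} :
    f ∈ srIdeal k (upper Δ d) ↔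
      f ∈ srIdeal k (upper Δ (d + 1)) ∧ ∀ K ∈ Δ, K.card = d → proj k K f = 0 := by
  simp only [mem_srIdeal_upper]
  refine ⟨fun h => ⟨fun K hK hd => h K hK (by omega), fun K hK hd => h K hK hd.ge⟩,
    fun h K hK hd => ?_⟩
  rcases hd.eq_or_lt with hd | hd
  · exact h.2 K hK hd.symm
  · exact h.1 K hK hd

lemma srIdeal_upper_le (Δ : Set (Finset V)) (d : ℕ) :
    srIdeal k (upper Δ d) ≤ srIdeal k (upper Δ (d + 1)) :=
  fun _ hf => (mem_srIdeal_upper_iff.1 hf).1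

end FaceIdeal

/-! ### Choice of a regular pair in a prime ideal -/

section Avoidance

lemma exists_mem_forall_notMem {R : Type*} [CommRing R] {S : Set (Ideal R)} (hS : S.Finite)
    (hprime : ∀ P ∈ S, P.IsPrime) {I : Ideal R} (hI : ∀ P ∈ S, ¬ I ≤ P) :
    ∃ x ∈ I, ∀ P ∈ S, x ∉ P := by
  by_contra! h
  have hsub : (I : Set R) ⊆ ⋃ P ∈ S, (P : Set R) := fun x hx => by
    obtain ⟨P, hP, hxP⟩ := h x hx
    exact Set.mem_biUnion hP hxP
  obtain ⟨P, hP, hle⟩ := (Ideal.subset_union_prime_finite hS (f := id) ⊥ ⊥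
    (fun P hP _ _ => hprime P hP)).1 hsub
  exact hI P hP hle

variable {k : Type*} [Field k] {V : Type*}

lemma comap_restr_span_singleton (K : Finset V) (q : MvPolynomial K k) :
    (Ideal.span {q}).comap (restr k K) =
      varIdeal k K ⊔ Ideal.span {rename Subtype.val q} := by
  refine le_antisymm (fun f hf => ?_) (sup_le (fun f hf => ?_) ?_)
  · obtain ⟨g, hg⟩ := Ideal.mem_span_singleton'.1 (Ideal.mem_comap.1 hf)
    rw [← sub_add_cancel f (rename Subtype.val (restr k K f))]
    refine Submodule.add_mem_sup (sub_rename_restr_mem K f) ?_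
    rw [← hg, map_mul]
    exact Ideal.mul_mem_left _ _ (Ideal.mem_span_singleton_self _)
  · rw [Ideal.mem_comap, show restr k K f = 0 from hf]
    exact zero_mem _
  · rw [Ideal.span_singleton_le_iff_mem, Ideal.mem_comap, restr_rename]
    exact Ideal.mem_span_singleton_self _

variable [Fintype V]

lemma not_le_varIdeal {p : Ideal (MvPolynomial V k)} {d e : ℕ}
    (hp : ((Fintype.card V + 1 + e : ℕ) : ℕ∞) ≤ p.height + d) {K : Finset V}
    (hK : d ≤ K.card + e) : ¬ p ≤ varIdeal k K := by
  intro hle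
  have h : ((Fintype.card V + 1 + e : ℕ) : ℕ∞) ≤ ((Fintype.card V + e : ℕ) : ℕ∞) := by
    refine hp.trans ((add_le_add (Ideal.height_mono hle) (Nat.cast_le.2 hK)).trans ?_)
    push_cast
    rw [← add_assoc]
    gcongr
    exact height_varIdeal_le K
  have := Nat.cast_le.1 h
  omega

lemma exists_mem_restr_ne_zero {p : Ideal (MvPolynomial V k)} {d : ℕ}
    (hp : ((Fintype.card V + 1 : ℕ) : ℕ∞) ≤ p.height + d) :
    ∃ x ∈ p, ∀ K : Finset V, K.card = d → proj k K x ≠ 0 := by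
  obtain ⟨x, hx, h⟩ := exists_mem_forall_notMem (S := varIdeal k '' {K : Finset V | K.card = d})
    (Set.toFinite _) (by rintro _ ⟨K, -, rfl⟩; infer_instance) (I := p)
    (by rintro _ ⟨K, hK, rfl⟩; exact not_le_varIdeal (e := 0) hp (Eq.ge hK))
  exact ⟨x, hx, fun K hK h0 => h _ ⟨K, hK, rfl⟩ (mem_varIdeal.2 h0)⟩

lemma exists_mem_isRelPrime_restr {p : Ideal (MvPolynomial V k)} {d : ℕ}
    (hp : ((Fintype.card V + 2 : ℕ) : ℕ∞) ≤ p.height + d) {x : MvPolynomial V k}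
    (hx : ∀ K : Finset V, K.card = d → proj k K x ≠ 0) :
    ∃ y ∈ p, (∀ K : Finset V, d ≤ K.card + 1 → proj k K y ≠ 0) ∧
      ∀ K : Finset V, K.card = d → IsRelPrime (restr k K x) (restr k K y) := by
  set S₁ : Set (Ideal (MvPolynomial V k)) := varIdeal k '' {K : Finset V | d ≤ K.card + 1}
  set S₂ : Set (Ideal (MvPolynomial V k)) := ⋃ K ∈ {K : Finset V | K.card = d},
    (fun q => (Ideal.span {q}).comap (restr k K)) ''
      {q | q ∈ UniqueFactorizationMonoid.factors (restr k K x)}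
  have hfin : (S₁ ∪ S₂).Finite := (Set.toFinite _).union <|
    (Set.toFinite _).biUnion fun K _ => (Multiset.finite_toSet _).image _
  have hS₂ : ∀ P ∈ S₂, P.IsPrime ∧ ¬ p ≤ P := by
    intro P hP
    simp only [S₂, Set.mem_iUnion] at hP
    obtain ⟨K, hK, q, hq, rfl⟩ := hP
    have hprime := UniqueFactorizationMonoid.prime_of_factor q hq
    have : (Ideal.span {q}).IsPrime := (Ideal.span_singleton_prime hprime.ne_zero).2 hprime
    have hP : ((Ideal.span {q}).comap (restr k K)).IsPrime := Ideal.comap_isPrime _ _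
    refine ⟨hP, fun hle => ?_⟩
    have h1 : ((Fintype.card V + 2 : ℕ) : ℕ∞) ≤ ((Fintype.card V + 1 : ℕ) : ℕ∞) := by
      refine hp.trans ((add_le_add (Ideal.height_mono hle) le_rfl).trans ?_)
      have hne := hP.ne_top
      simp only [comap_restr_span_singleton] at hne ⊢
      rw [← show K.card = d from hK]
      exact_mod_cast height_varIdeal_sup_le K _ hne
    have := Nat.cast_le.1 h1
    omega
  obtain ⟨y, hy, h⟩ := exists_mem_forall_notMem hfin (I := p)
    (by
      rintro P (⟨K, -, rfl⟩ | hP)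
      · infer_instance
      · exact (hS₂ P hP).1)
    (by
      rintro P (⟨K, hK, rfl⟩ | hP)
      · exact not_le_varIdeal (e := 1) hp hK
      · exact (hS₂ P hP).2)
  refine ⟨y, hy, fun K hK h0 => h _ (Or.inl ⟨K, hK, rfl⟩) (mem_varIdeal.2 h0), fun K hK => ?_⟩
  have hxK : restr k K x ≠ 0 := fun h0 => hx K hK (proj_eq_zero_iff_restr.2 h0)
  rw [UniqueFactorizationMonoid.isRelPrime_iff_no_prime_factors hxK]
  intro q hqx hqy hq
  obtain ⟨q', hq', hassoc⟩ :=
    UniqueFactorizationMonoid.exists_mem_factors_of_dvd hxK hq.irreducible hqx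
  refine h _ (Or.inr (Set.mem_biUnion (x := K) hK ⟨q', hq', rfl⟩)) ?_
  exact Ideal.mem_span_singleton.2 (hassoc.dvd_iff_dvd_left.1 hqy)

end Avoidance

/-! ### Regular elements on subquotients of face ideals -/

section Regular

lemma isSMulRegular_subquot {A : Type*} [CommRing A] {J J' : Ideal A} {x : A}
    (h : ∀ f ∈ J', x * f ∈ J → f ∈ J) : IsSMulRegular (subquot J J') x :=
  (isSMulRegular_quotient_iff_mem_of_smul_mem _ _).2 fun f hf => h f f.2 hf

lemma isSMulRegular_quotSMulTop_subquot {A : Type*} [CommRing A] {J J' : Ideal A} {x y : A}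
    (h : ∀ f ∈ J', ∀ g ∈ J', y * f - x * g ∈ J → ∃ e ∈ J', f - x * e ∈ J) :
    IsSMulRegular (QuotSMulTop x (subquot J J')) y := by
  refine (isSMulRegular_quotient_iff_mem_of_smul_mem _ _).2 fun f hf => ?_
  obtain ⟨f, rfl⟩ := Submodule.Quotient.mk_surjective _ f
  obtain ⟨g, -, hg⟩ := (Submodule.mem_smul_pointwise_iff_exists _ _ _).1 hf
  obtain ⟨g, rfl⟩ := Submodule.Quotient.mk_surjective _ g
  rw [← Submodule.Quotient.mk_smul, ← Submodule.Quotient.mk_smul, eq_comm,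
    Submodule.Quotient.eq] at hg
  obtain ⟨e, he, hfe⟩ := h f f.2 g g.2 hg
  refine (Submodule.mem_smul_pointwise_iff_exists _ _ _).2
    ⟨Submodule.Quotient.mk ⟨e, he⟩, trivial, ?_⟩
  rw [← Submodule.Quotient.mk_smul, eq_comm, Submodule.Quotient.eq]
  exact hfe

variable {k : Type*} [Field k] {V : Type*}

lemma mem_srIdeal_upper_of_mul_mem {Δ : Set (Finset V)} {d : ℕ} {x f : MvPolynomial V k}
    (hx : ∀ K : Finset V, K.card = d → proj k K x ≠ 0)
    (hf : f ∈ srIdeal k (upper Δ (d + 1))) (hxf : x * f ∈ srIdeal k (upper Δ d)) :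
    f ∈ srIdeal k (upper Δ d) := by
  rw [mem_srIdeal_upper_iff] at hxf ⊢
  refine ⟨hf, fun K hK hd => ?_⟩
  have := hxf.2 K hK hd
  rw [map_mul] at this
  exact (mul_eq_zero.1 this).resolve_left (hx K hd)

lemma exists_coeff_eq_of_finite {ι : Type*} [Finite ι] (n : ι → MvPolynomial V k)
    (c : (V →₀ ℕ) → k) (hc : ∀ a, c a ≠ 0 → ∃ i, coeff a (n i) ≠ 0) :
    ∃ h : MvPolynomial V k, ∀ a, coeff a h = c a := by
  classical
  have hfin : (Function.support c).Finite :=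
    (Set.finite_iUnion fun i => (n i).support.finite_toSet).subset fun a ha => by
      obtain ⟨i, hi⟩ := hc a ha
      exact Set.mem_iUnion.2 ⟨i, by simpa using hi⟩
  exact ⟨AddMonoidAlgebra.ofCoeff (Finsupp.ofSupportFinite c hfin), fun a => rfl⟩

lemma coeff_proj_of_subset {K : Finset V} {a : V →₀ ℕ} (h : a.support ⊆ K)
    (f : MvPolynomial V k) : coeff a (proj k K f) = coeff a f := by
  classical
  rw [coeff_proj, if_pos h]

lemma exists_proj_eq_mul {K : Finset V} {x y f g : MvPolynomial V k}
    (hx : proj k K x ≠ 0) (hrel : IsRelPrime (restr k K x) (restr k K y))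
    (h : proj k K (y * f) = proj k K (x * g)) :
    ∃ n, proj k K n = n ∧ proj k K f = proj k K x * n ∧ proj k K g = proj k K y * n := by
  have h' : restr k K y * restr k K f = restr k K x * restr k K g := by
    apply rename_injective _ (Subtype.val_injective (p := (· ∈ K)))
    rw [← map_mul, ← map_mul]
    exact h
  obtain ⟨n, hn⟩ := hrel.dvd_of_dvd_mul_left (Dvd.intro _ h'.symm)
  have hn' : restr k K g = restr k K y * n := by
    refine mul_left_cancel₀ (fun h0 => hx (proj_eq_zero_iff_restr.2 h0)) ?_
    rw [← h', hn]
    ring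
  refine ⟨rename Subtype.val n, ?_, ?_, ?_⟩
  · simp [proj, restr_rename]
  · simp [proj, hn]
  · simp [proj, hn']

variable [Fintype V] [DecidableEq V]

lemma exists_sub_mul_mem_srIdeal_upper {G : SimpleGraph V} {d : ℕ}
    (hG : ∀ A ∈ indepComplex G, ∀ B ∈ indepComplex G, A.card = d → B.card = d →
      IndepChain G (A ∩ B) d A B)
    {x y : MvPolynomial V k} (hx : ∀ K : Finset V, K.card = d → proj k K x ≠ 0)
    (hy : ∀ K : Finset V, d ≤ K.card + 1 → proj k K y ≠ 0)
    (hxy : ∀ K : Finset V, K.card = d → IsRelPrime (restr k K x) (restr k K y))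
    {f g : MvPolynomial V k} (hf : f ∈ srIdeal k (upper (indepComplex G) (d + 1)))
    (hfg : y * f - x * g ∈ srIdeal k (upper (indepComplex G) d)) :
    ∃ e ∈ srIdeal k (upper (indepComplex G) (d + 1)),
      f - x * e ∈ srIdeal k (upper (indepComplex G) d) := by
  set Δ := indepComplex G with hΔ
  have key : ∀ K : Finset V, ∃ n, K ∈ Δ → K.card = d →
      proj k K n = n ∧ proj k K f = proj k K x * n ∧ proj k K g = proj k K y * n := by
    intro K
    by_cases hK : K ∈ Δ ∧ K.card = d
    · obtain ⟨n, hn⟩ := exists_proj_eq_mul (hx K hK.2) (hxy K hK.2) (f := f) (g := g) (by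
        rw [← sub_eq_zero, ← map_sub]
        exact mem_srIdeal_upper.1 hfg K hK.1 hK.2.ge)
      exact ⟨n, fun _ _ => hn⟩
    · exact ⟨0, fun h1 h2 => absurd ⟨h1, h2⟩ hK⟩
  choose n hn using key
  have hadj : ∀ K ∈ Δ, ∀ L ∈ Δ, K.card = d → L.card = d → d ≤ (K ∩ L).card + 1 →
      proj k (K ∩ L) (n K) = proj k (K ∩ L) (n L) := by
    intro K hK L hL hKd hLd hKL
    refine mul_left_cancel₀ (hy _ hKL) ?_
    have h1 := congrArg (proj k (K ∩ L)) (hn K hK hKd).2.2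
    have h2 := congrArg (proj k (K ∩ L)) (hn L hL hLd).2.2
    rw [map_mul, proj_proj_of_subset Finset.inter_subset_left,
      proj_proj_of_subset Finset.inter_subset_left] at h1
    rw [map_mul, proj_proj_of_subset Finset.inter_subset_right,
      proj_proj_of_subset Finset.inter_subset_right] at h2
    rw [← h1, ← h2]
  have hchain : ∀ K ∈ Δ, ∀ L ∈ Δ, K.card = d → L.card = d → ∀ a : V →₀ ℕ, a.support ⊆ K →
      a.support ⊆ L → coeff a (n K) = coeff a (n L) := by
    intro K hK L hL hKd hLd a haK haL
    have haKL := Finset.subset_inter haK haL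
    have hc := hG K hK L hL hKd hLd
    unfold IndepChain at hc
    generalize hW : K ∩ L = W at hc haKL
    clear haL hL hLd hW
    induction hc with
    | refl => rfl
    | tail _ h ih =>
      refine ih.trans ?_
      have := hadj _ h.1.1 _ h.2.1.1 h.1.2.1 h.2.1.2.1 h.2.2
      have hs := Finset.subset_inter (haKL.trans h.1.2.2) (haKL.trans h.2.1.2.2)
      rw [← coeff_proj_of_subset hs, this, coeff_proj_of_subset hs]
  have hc : ∀ a : V →₀ ℕ, ∃ c : k,
      (∀ K ∈ Δ, K.card = d → a.support ⊆ K → coeff a (n K) = c) ∧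
      (c ≠ 0 → ∃ K ∈ Δ, K.card = d ∧ a.support ⊆ K ∧ coeff a (n K) = c) := by
    intro a
    by_cases ha : ∃ K ∈ Δ, K.card = d ∧ a.support ⊆ K
    · obtain ⟨K, hK, hKd, haK⟩ := ha
      exact ⟨coeff a (n K), fun L hL hLd haL => hchain L hL K hK hLd hKd a haL haK,
        fun _ => ⟨K, hK, hKd, haK, rfl⟩⟩
    · exact ⟨0, fun K hK hKd haK => absurd ⟨K, hK, hKd, haK⟩ ha, fun h => absurd rfl h⟩
  choose c hc₁ hc₂ using hc
  obtain ⟨e, he⟩ := exists_coeff_eq_of_finite n c fun a ha => by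
    obtain ⟨K, -, -, -, h⟩ := hc₂ a ha
    exact ⟨K, h ▸ ha⟩
  have hproj : ∀ K ∈ Δ, K.card = d → proj k K e = n K := by
    intro K hK hKd
    rw [← (hn K hK hKd).1]
    ext a
    rw [coeff_proj, coeff_proj]
    split_ifs with ha
    · rw [he, hc₁ a K hK hKd ha]
    · rfl
  have heJ : e ∈ srIdeal k (upper Δ (d + 1)) := by
    rw [mem_srIdeal (isComplex_upper _ _)]
    rintro a ha ⟨K, hK, hKd, haK⟩
    rw [mem_support_iff, he] at ha
    obtain ⟨K', -, hKd', haK', -⟩ := hc₂ a ha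
    obtain ⟨L, haL, hLK, hLd⟩ := Finset.exists_subsuperset_card_eq haK
      ((Finset.card_le_card haK').trans_eq hKd') (by omega : d ≤ K.card)
    have hL : L ∈ Δ := fun u hu v hv => hK u (hLK hu) v (hLK hv)
    refine ha ?_
    rw [← hc₁ a L hL hLd haL]
    have hfL : proj k L f = 0 := by
      rw [← proj_proj_of_subset hLK, mem_srIdeal_upper.1 hf K hK hKd, map_zero]
    rw [(hn L hL hLd).2.1] at hfL
    rw [(mul_eq_zero.1 hfL).resolve_left (hx L hLd), coeff_zero]
  refine ⟨e, heJ, mem_srIdeal_upper_iff.2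
    ⟨sub_mem hf (Ideal.mul_mem_left _ _ heJ), fun K hK hKd => ?_⟩⟩
  rw [map_sub, map_mul, hproj K hK hKd, (hn K hK hKd).2.1, sub_self]

end Regular

/-! ### Dimension and depth of the subquotients -/

section Dimension

lemma withBot_enat_le_of_forall {a : WithBot ℕ∞} {b : ℕ∞}
    (h : ∀ m : ℕ, (m : WithBot ℕ∞) ≤ a → (m : ℕ∞) ≤ b) : a ≤ b := by
  induction a with
  | bot => exact bot_le
  | coe a =>
    exact WithBot.coe_le_coe.2 (ENat.forall_natCast_le_iff_le.1 fun m hm =>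
      h m (WithBot.coe_le_coe.2 hm))

lemma exists_height_add_le_of_le_ringKrullDim {R T : Type*} [CommRing R] [CommRing T]
    (φ : R →+* T) (hφ : Function.Injective (PrimeSpectrum.comap φ)) {m : ℕ}
    (hm : (m : WithBot ℕ∞) ≤ ringKrullDim T) :
    ∃ P Q : PrimeSpectrum T,
      (PrimeSpectrum.comap φ P).asIdeal.height + m ≤ (PrimeSpectrum.comap φ Q).asIdeal.height := by
  obtain ⟨l, rfl⟩ := Order.le_krullDim_iff.1 hm
  have hmono : ∀ {P Q : PrimeSpectrum T}, P < Q →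
      (PrimeSpectrum.comap φ P).asIdeal < (PrimeSpectrum.comap φ Q).asIdeal := by
    intro P Q h
    refine lt_of_le_of_ne (Ideal.comap_mono h.le) fun he => h.ne (hφ (PrimeSpectrum.ext he))
  have key : ∀ i : Fin (l.length + 1), (PrimeSpectrum.comap φ (l 0)).asIdeal.height + (i : ℕ) ≤
      (PrimeSpectrum.comap φ (l i)).asIdeal.height := by
    intro i
    induction i using Fin.induction with
    | zero => simp
    | succ i ih =>
      have := Ideal.height_add_one_le_of_lt_of_isPrime (hmono (l.step i))
      refine le_trans ?_ this
      rw [Fin.val_succ, Nat.cast_add, Nat.cast_one, ← add_assoc]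
      gcongr
      exact ih
  exact ⟨l 0, l (Fin.last _), key (Fin.last _)⟩

lemma exists_height_add_le_of_le_mDim_localization {R M : Type*} [CommRing R] [AddCommGroup M]
    [Module R M] (p : Ideal R) [p.IsPrime] {m : ℕ}
    (hm : (m : WithBot ℕ∞) ≤
      mDim (Localization p.primeCompl) (LocalizedModule p.primeCompl M)) :
    ∃ P : Ideal R, P.IsPrime ∧ Module.annihilator R M ≤ P ∧ P.height + m ≤ p.height := by
  set S := Localization p.primeCompl
  set N := LocalizedModule p.primeCompl M
  set ψ := Ideal.Quotient.mk (Module.annihilator S N)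
  obtain ⟨P, Q, h⟩ := exists_height_add_le_of_le_ringKrullDim (ψ.comp (algebraMap R S))
    (fun P Q h => PrimeSpectrum.comap_injective_of_surjective ψ Ideal.Quotient.mk_surjective
      (PrimeSpectrum.localization_comap_injective S p.primeCompl h)) hm
  refine ⟨_, (PrimeSpectrum.comap (ψ.comp (algebraMap R S)) P).isPrime, fun r hr => ?_,
    h.trans (Ideal.height_mono ?_)⟩
  · change ψ (algebraMap R S r) ∈ P.asIdeal
    have h0 : ψ (algebraMap R S r) = 0 := by
      refine Ideal.Quotient.eq_zero_iff_mem.2 (Module.mem_annihilator.2 fun n => ?_)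
      induction n using LocalizedModule.induction_on with
      | h x s =>
        rw [algebraMap_smul, LocalizedModule.smul'_mk, Module.mem_annihilator.1 hr x,
          LocalizedModule.zero_mk]
    rw [h0]
    exact zero_mem _
  · have h1 := IsLocalRing.le_maximalIdeal
      (PrimeSpectrum.comap ψ Q).isPrime.ne_top
    exact (Ideal.comap_mono h1).trans_eq Localization.AtPrime.under_maximalIdeal

lemma nontrivial_of_zero_le_mDim {A M : Type*} [CommRing A] [AddCommGroup M] [Module A M]
    (h : 0 ≤ mDim A M) : Nontrivial M := by
  by_contra hM
  rw [not_nontrivial_iff_subsingleton] at hM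
  rw [mDim, Module.annihilator_eq_top_iff.2 hM] at h
  have : Subsingleton (A ⧸ (⊤ : Ideal A)) := Ideal.Quotient.subsingleton_iff.2 rfl
  rw [ringKrullDim_eq_bot_of_subsingleton] at h
  simp at h

lemma length_le_depthIn_localization {R M : Type*} [CommRing R] [AddCommGroup M] [Module R M]
    [Module.Finite R M] (p : Ideal R) [p.IsPrime]
    [Nontrivial (LocalizedModule p.primeCompl M)] {rs : List R}
    (hrs : RingTheory.Sequence.IsWeaklyRegular M rs) (hmem : ∀ r ∈ rs, r ∈ p) :
    (rs.length : ℕ∞) ≤ depthIn (Localization p.primeCompl)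
      (Ideal.map (algebraMap R (Localization p.primeCompl)) p)
      (LocalizedModule p.primeCompl M) := by
  refine le_sSup ⟨rs.map (algebraMap R _), ?_, hrs.isRegular_of_isLocalizedModule_of_mem
    (Localization p.primeCompl) p (LocalizedModule.mkLinearMap p.primeCompl M) hmem, by simp⟩
  intro x hx
  obtain ⟨r, hr, rfl⟩ := List.mem_map.1 hx
  exact Ideal.mem_map_of_mem _ (hmem r hr)

lemma mem_annihilator_subquot {A : Type*} [CommRing A] {J J' : Ideal A} {r : A} :
    r ∈ Module.annihilator A (subquot J J') ↔ ∀ f ∈ J', r * f ∈ J := by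
  rw [Module.mem_annihilator]
  refine ⟨fun h f hf => ?_, fun h m => ?_⟩
  · have := h (Submodule.Quotient.mk ⟨f, hf⟩)
    rwa [← Submodule.Quotient.mk_smul, Submodule.Quotient.mk_eq_zero] at this
  · obtain ⟨f, rfl⟩ := Submodule.Quotient.mk_surjective _ m
    rw [← Submodule.Quotient.mk_smul, Submodule.Quotient.mk_eq_zero]
    exact h f f.2

variable {k : Type*} [Field k] {V : Type*} [Fintype V]

lemma exists_varIdeal_le_of_annihilator_le {Δ : Set (Finset V)} {d : ℕ}
    {P : Ideal (MvPolynomial V k)} (hP : P.IsPrime)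
    (hann : Module.annihilator (MvPolynomial V k)
      (subquot (srIdeal k (upper Δ d)) (srIdeal k (upper Δ (d + 1)))) ≤ P) :
    ∃ K ∈ Δ, K.card = d ∧ varIdeal k K ≤ P := by
  classical
  have hinf : (Finset.univ.filter fun K => K ∈ Δ ∧ K.card = d).inf (varIdeal k) ≤ P := by
    refine le_trans (fun r hr => mem_annihilator_subquot.2 fun f hf => ?_) hann
    refine mem_srIdeal_upper_iff.2 ⟨Ideal.mul_mem_left _ _ hf, fun K hK hd => ?_⟩
    rw [Submodule.mem_finsetInf] at hr
    rw [map_mul, mem_varIdeal.1 (hr K (by simp [hK, hd])), zero_mul]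
  obtain ⟨K, hK, hle⟩ := hP.inf_le'.1 hinf
  simp only [Finset.mem_filter, Finset.mem_univ, true_and] at hK
  exact ⟨K, hK.1, hK.2, hle⟩

lemma card_add_le_height_add {P Q : Ideal (MvPolynomial V k)} {K : Finset V} {d m : ℕ}
    (hKd : K.card = d) (hK : varIdeal k K ≤ P) (h : P.height + m ≤ Q.height) :
    ((Fintype.card V + m : ℕ) : ℕ∞) ≤ Q.height + d := by
  calc ((Fintype.card V + m : ℕ) : ℕ∞) ≤ ((varIdeal k K).height + d) + m := by
        push_cast
        gcongr
        exact hKd ▸ le_height_varIdeal K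
    _ ≤ (P.height + m) + d := by
        rw [add_right_comm]
        gcongr
    _ ≤ Q.height + d := by gcongr

lemma mDim_subquot_srIdeal_upper {Δ : Set (Finset V)} {d : ℕ}
    (h : srIdeal k (upper Δ d) < srIdeal k (upper Δ (d + 1))) :
    mDim (MvPolynomial V k)
      (subquot (srIdeal k (upper Δ d)) (srIdeal k (upper Δ (d + 1)))) = d := by
  refine le_antisymm (withBot_enat_le_of_forall (b := (d : ℕ∞)) fun m hm => ?_) ?_
  · obtain ⟨P, Q, hPQ⟩ := exists_height_add_le_of_le_ringKrullDim (Ideal.Quotient.mk _)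
      (PrimeSpectrum.comap_injective_of_surjective _ Ideal.Quotient.mk_surjective) hm
    have hann : Module.annihilator (MvPolynomial V k)
        (subquot (srIdeal k (upper Δ d)) (srIdeal k (upper Δ (d + 1)))) ≤
        (PrimeSpectrum.comap (Ideal.Quotient.mk _) P).asIdeal := by
      intro r hr
      rw [PrimeSpectrum.comap_asIdeal, Ideal.mem_comap, Ideal.Quotient.eq_zero_iff_mem.2 hr]
      exact zero_mem _
    obtain ⟨K, -, hKd, hle⟩ :=
      exists_varIdeal_le_of_annihilator_le (PrimeSpectrum.isPrime _) hann
    have h1 := card_add_le_height_add hKd hle hPQ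
    have h2 := Ideal.height_le_ringKrullDim_of_ne_top
      (PrimeSpectrum.comap (Ideal.Quotient.mk _) Q).isPrime.ne_top
    rw [show ringKrullDim (MvPolynomial V k) = ((Fintype.card V : ℕ∞) : WithBot ℕ∞) by simp,
      WithBot.coe_le_coe] at h2
    have h3 : ((Fintype.card V + m : ℕ) : ℕ∞) ≤ ((Fintype.card V + d : ℕ) : ℕ∞) := by
      refine h1.trans ?_
      push_cast
      gcongr
    have := Nat.cast_le.1 h3
    exact Nat.cast_le.2 (by omega)
  · obtain ⟨f, hf, hf'⟩ := SetLike.exists_of_lt h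
    rw [mem_srIdeal_upper_iff] at hf'
    push Not at hf'
    obtain ⟨K, hK, hKd, hfK⟩ := hf' hf
    have hann : Module.annihilator (MvPolynomial V k)
        (subquot (srIdeal k (upper Δ d)) (srIdeal k (upper Δ (d + 1)))) ≤ varIdeal k K := by
      intro r hr
      have := mem_srIdeal_upper.1 (mem_annihilator_subquot.1 hr f hf) K hK hKd.ge
      rw [map_mul] at this
      exact mem_varIdeal.2 ((mul_eq_zero.1 this).resolve_right hfK)
    have := ringKrullDim_le_of_surjective _ (Ideal.Quotient.factor_surjective hann)
    rwa [ringKrullDim_quotient_varIdeal, hKd] at this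

lemma isSerreMod_two_subquot_srIdeal_upper [DecidableEq V] {G : SimpleGraph V} {d : ℕ}
    (hG : ∀ A ∈ indepComplex G, ∀ B ∈ indepComplex G, A.card = d → B.card = d →
      IndepChain G (A ∩ B) d A B) :
    IsSerreMod 2 (MvPolynomial V k) (subquot (srIdeal k (upper (indepComplex G) d))
      (srIdeal k (upper (indepComplex G) (d + 1)))) := by
  intro p _
  refine withBot_enat_le_of_forall fun m hm => ?_
  obtain ⟨hm₂, hm⟩ := le_min_iff.1 hm
  have hm₂ : m ≤ 2 := by exact_mod_cast hm₂
  have := nontrivial_of_zero_le_mDim (le_trans (by exact_mod_cast Nat.zero_le m) hm)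
  obtain ⟨P, hP, hann, hPp⟩ := exists_height_add_le_of_le_mDim_localization p hm
  obtain ⟨K, -, hKd, hle⟩ := exists_varIdeal_le_of_annihilator_le hP hann
  have hp := card_add_le_height_add hKd hle hPp
  rcases Nat.eq_zero_or_pos m with rfl | hm0
  · simp
  obtain ⟨x, hxp, hx⟩ := exists_mem_restr_ne_zero (p := p) (d := d)
    (le_trans (Nat.cast_le.2 (by omega)) hp)
  have hxreg : IsSMulRegular (subquot (srIdeal k (upper (indepComplex G) d))
      (srIdeal k (upper (indepComplex G) (d + 1)))) x :=
    isSMulRegular_subquot fun f hf hxf => mem_srIdeal_upper_of_mul_mem hx hf hxf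
  obtain rfl | rfl : m = 1 ∨ m = 2 := by omega
  · exact length_le_depthIn_localization p (rs := [x])
      ((RingTheory.Sequence.isWeaklyRegular_cons_iff _ _ _).2
        ⟨hxreg, RingTheory.Sequence.IsWeaklyRegular.nil _ _⟩) (by simpa using hxp)
  · obtain ⟨y, hyp, hy, hxy⟩ := exists_mem_isRelPrime_restr hp hx
    refine length_le_depthIn_localization p (rs := [x, y])
      ((RingTheory.Sequence.isWeaklyRegular_cons_iff _ _ _).2
        ⟨hxreg, (RingTheory.Sequence.isWeaklyRegular_cons_iff _ _ _).2
          ⟨isSMulRegular_quotSMulTop_subquot fun f hf g _ hfg => ?_,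
            RingTheory.Sequence.IsWeaklyRegular.nil _ _⟩⟩) (by simp [hxp, hyp])
    exact exists_sub_mul_mem_srIdeal_upper hG hx hy hxy hf hfg

end Dimension

/-! ### Assembling the filtration -/

section Filtration

variable {k : Type*} [Field k] {V : Type*}

lemma isSeqSerre_of_monotone {Δ : Set (Finset V)} {r N : ℕ}
    (J : ℕ → Ideal (MvPolynomial V k)) (h0 : J 0 = srIdeal k Δ) (hN : J N = ⊤)
    (hmono : ∀ i, J i ≤ J (i + 1)) (hhom : ∀ i, IsHomogeneousIdeal k (J i))
    (hS : ∀ i, IsSerreMod r (MvPolynomial V k) (subquot (J i) (J (i + 1))))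
    (hdim : ∀ i, J i < J (i + 1) →
      mDim (MvPolynomial V k) (subquot (J i) (J (i + 1))) = i) :
    IsSeqSerre k Δ r := by
  suffices H : ∀ N, ∃ (t : ℕ) (I : ℕ → Ideal (MvPolynomial V k)),
      I 0 = J 0 ∧ I t = J N ∧ (∀ i ≤ t, IsHomogeneousIdeal k (I i)) ∧
      (∀ i < t, I i < I (i + 1)) ∧
      (∀ i < t, IsSerreMod r (MvPolynomial V k) (subquot (I i) (I (i + 1)))) ∧
      (∀ i < t, mDim (MvPolynomial V k) (subquot (I i) (I (i + 1))) < N) ∧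
      (∀ i : ℕ, i + 2 ≤ t →
        mDim (MvPolynomial V k) (subquot (I i) (I (i + 1))) <
          mDim (MvPolynomial V k) (subquot (I (i + 1)) (I (i + 2)))) by
    obtain ⟨t, I, hI0, hIt, hI1, hI2, hI3, -, hI4⟩ := H N
    exact ⟨t, I, hI0.trans h0, hIt.trans hN, hI1, hI2, hI3, hI4⟩
  clear h0 hN N
  intro N
  induction N with
  | zero => exact ⟨0, J, rfl, rfl, fun i _ => hhom i, by simp, by simp, by simp, by simp⟩
  | succ N ih =>
    obtain ⟨t, I, hI0, hIt, hI1, hI2, hI3, hI4, hI5⟩ := ih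
    have hlt : ((N : ℕ) : WithBot ℕ∞) < ((N + 1 : ℕ) : WithBot ℕ∞) := by
      exact_mod_cast Nat.lt_succ_self N
    rcases (hmono N).eq_or_lt with heq | hJ
    · exact ⟨t, I, hI0, hIt.trans heq, hI1, hI2, hI3, fun i hi => (hI4 i hi).trans hlt, hI5⟩
    obtain ⟨I', hI', hIlast⟩ : ∃ I' : ℕ → Ideal (MvPolynomial V k),
        (∀ i ≤ t, I' i = I i) ∧ I' (t + 1) = J (N + 1) :=
      ⟨fun i => if i ≤ t then I i else J (N + 1), fun i hi => if_pos hi, if_neg (by simp)⟩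
    have hstep : ∀ C : Ideal (MvPolynomial V k) → Ideal (MvPolynomial V k) → Prop,
        (∀ i < t, C (I i) (I (i + 1))) → C (J N) (J (N + 1)) →
        ∀ i < t + 1, C (I' i) (I' (i + 1)) := by
      intro C h1 h2 i hi
      rcases (Nat.lt_succ_iff.1 hi).eq_or_lt with rfl | hi
      · rwa [hI' i le_rfl, hIlast, hIt]
      · rw [hI' i hi.le, hI' (i + 1) hi]
        exact h1 i hi
    refine ⟨t + 1, I', (hI' 0 (Nat.zero_le _)).trans hI0, hIlast, ?_, hstep (· < ·) hI2 hJ,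
      hstep (fun A B => IsSerreMod r (MvPolynomial V k) (subquot A B)) hI3 (hS N),
      hstep (fun A B => mDim (MvPolynomial V k) (subquot A B) < ((N + 1 : ℕ) : WithBot ℕ∞))
        (fun i hi => (hI4 i hi).trans hlt) (by rw [hdim N hJ]; exact hlt), ?_⟩
    · intro i hi
      rcases hi.eq_or_lt with rfl | hi
      · rw [hIlast]
        exact hhom _
      · rw [hI' i (by omega)]
        exact hI1 i (by omega)
    · intro i hi
      rcases hi.eq_or_lt with hi | hi
      · obtain rfl : t = i + 1 := by omega
        rw [hI' i (by omega), hI' (i + 1) le_rfl, hIlast, hIt, hdim N hJ, ← hIt]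
        exact hI4 i (by omega)
      · rw [hI' i (by omega), hI' (i + 1) (by omega), hI' (i + 2) (by omega)]
        exact hI5 i (by omega)

lemma isComplex_indepComplex (G : SimpleGraph V) : IsComplex (indepComplex G) :=
  fun _ hF _ h x hx y hy => hF x (h hx) y (h hy)

end Filtration

/-- **Whiskering chordless even cycles forces sequentially `S_2`.**
Let `G` be a finite simple graph and suppose that in each chordless even cycle of
`G` some vertex of the cycle has a whisker, i.e. is adjacent to a vertex of degree
`1` in `G`.  Then `G` is sequentially `S_2` over any field `k`. -/
theorem isSeqSerre_two_of_whiskered_even_cycles (k : Type*) [Field k]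
    (V : Type*) [Fintype V] (G : SimpleGraph V)
    (h : ∀ m : ℕ, Even m → 3 ≤ m → ∀ f : ZMod m → V, Function.Injective f →
      (∀ i j : ZMod m, G.Adj (f i) (f j) ↔ (j = i + 1 ∨ i = j + 1)) →
      ∃ (i : ZMod m) (z : V), G.Adj (f i) z ∧ ∀ u : V, G.Adj z u → u = f i) :
    IsSeqSerre k (indepComplex G) 2 := by
  classical
  refine isSeqSerre_of_monotone (N := Fintype.card V + 1)
    (fun d => srIdeal k (upper (indepComplex G) d)) ?_ ?_ (srIdeal_upper_le _)
    (fun d => (isComplex_upper _ d).isHomogeneousIdeal_srIdeal)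
    (fun d => isSerreMod_two_subquot_srIdeal_upper fun A hA B hB hAd hBd =>
      indepChain_of_whiskered h d A B hA hB hAd hBd)
    (fun d hd => mDim_subquot_srIdeal_upper hd)
  · rw [(isComplex_indepComplex G).upper_zero]
  · rw [upper_card_succ, srIdeal_empty]

end SeqSr
end

section
/- If G is a finite simple graph with no chordless even cycle, then G is sequentially S_2 over any field k. -/
open MvPolynomial

namespace SeqSr

/-- `G` has a chordless (induced) cycle of length `m`: there is an injective map
`f : ZMod m → V` such that two vertices `f i`, `f j` are adjacent in `G` exactly
when `i` and `j` are consecutive modulo `m`. -/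
def HasChordlessCycle {V : Type*} (G : SimpleGraph V) (m : ℕ) : Prop :=
  3 ≤ m ∧ ∃ f : ZMod m → V, Function.Injective f ∧
    ∀ i j : ZMod m, G.Adj (f i) (f j) ↔ (j = i + 1 ∨ i = j + 1)

/-! ### Strong connectivity of independence complexes -/

section Combinatorics

variable {V : Type*}

/-- The first `l + 1` values of `f` form an induced path of `G` inside `X`. -/
def IsInducedPath (G : SimpleGraph V) (X : Set V) (f : ℕ → V) (l : ℕ) : Prop :=
  (∀ i ≤ l, f i ∈ X) ∧ (∀ i ≤ l, ∀ j ≤ l, f i = f j → i = j) ∧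
    ∀ i ≤ l, ∀ j ≤ l, G.Adj (f i) (f j) ↔ (j = i + 1 ∨ i = j + 1)

/-- Closing up an induced path by a vertex adjacent to its two ends only gives a chordless
cycle. -/
lemma IsInducedPath.hasChordlessCycle {G : SimpleGraph V} {X : Set V} {f : ℕ → V} {l : ℕ}
    (hf : IsInducedPath G X f l) (hl : 1 ≤ l) {u : V} (hu : ∀ i ≤ l, f i ≠ u)
    (hadj : ∀ i ≤ l, G.Adj u (f i) ↔ (i = 0 ∨ i = l)) :
    HasChordlessCycle G (l + 2) := by
  obtain ⟨-, hinj, hpath⟩ := hf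
  refine ⟨by omega, ?_⟩
  let g : ℕ → V := fun i => if i = 0 then u else f (i - 1)
  have hval : ∀ i j : Fin (l + 2), i = j + 1 ↔
      ((i : ℕ) = j + 1 ∨ ((i : ℕ) = 0 ∧ (j : ℕ) = l + 1)) := by
    intro i j
    have hi := i.isLt
    have hj := j.isLt
    rw [Fin.ext_iff, Fin.val_add_one]
    split_ifs with hlast
    · have : (j : ℕ) = l + 1 := by rw [hlast]; rfl
      omega
    · have : (j : ℕ) ≠ l + 1 := fun hc => hlast (Fin.ext hc)
      omega
  have key : ∃ f : Fin (l + 2) → V, Function.Injective f ∧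
      ∀ i j : Fin (l + 2), G.Adj (f i) (f j) ↔ (j = i + 1 ∨ i = j + 1) := by
    refine ⟨fun i => g i, ?_, ?_⟩
    · intro i j hij
      have hi := i.isLt
      have hj := j.isLt
      apply Fin.ext
      simp only [g] at hij
      split_ifs at hij with h1 h2 h2
      · omega
      · exact absurd hij.symm (hu _ (by omega))
      · exact absurd hij (hu _ (by omega))
      · have := hinj _ (by omega) _ (by omega) hij
        omega
    · intro i j
      have hi := i.isLt
      have hj := j.isLt
      rw [hval, hval]
      simp only [g]
      split_ifs with h1 h2 h2
      · simp only [SimpleGraph.irrefl, false_iff]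
        omega
      · rw [hadj _ (by omega)]
        omega
      · rw [G.adj_comm, hadj _ (by omega)]
        omega
      · rw [hpath _ (by omega) _ (by omega)]
        omega
  exact key

/-- A finite bipartite graph in which every vertex has at least two neighbours has a chordless
cycle of even length. -/
lemma exists_even_chordlessCycle [Finite V] {G : SimpleGraph V} {X : Set V} (hX : X.Nonempty)
    (c : V → Prop) (hc : ∀ x ∈ X, ∀ y ∈ X, G.Adj x y → (c x ↔ ¬ c y))
    (hdeg : ∀ x ∈ X, ∀ y, ∃ z ∈ X, z ≠ y ∧ G.Adj x z) :
    ∃ m, Even m ∧ HasChordlessCycle G m := by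
  classical
  have := Fintype.ofFinite V
  obtain ⟨x₀, hx₀⟩ := hX
  have hbound : ∀ l, (∃ f, IsInducedPath G X f l) → l ≤ Fintype.card V := by
    rintro l ⟨f, -, hinj, -⟩
    have hinj' : Function.Injective (fun i : Fin (l + 1) => f i) := fun i j hij =>
      Fin.ext (hinj _ (by omega) _ (by omega) hij)
    have := Fintype.card_le_of_injective _ hinj'
    simp only [Fintype.card_fin] at this
    omega
  have hzero : ∃ f, IsInducedPath G X f 0 :=
    ⟨fun _ => x₀, fun _ _ => hx₀, fun i hi j hj _ => by omega, fun i hi j hj => by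
      simp only [SimpleGraph.irrefl, false_iff]; omega⟩
  obtain ⟨f, hf⟩ := Nat.findGreatest_spec (P := fun l => ∃ f, IsInducedPath G X f l)
    (Nat.zero_le (Fintype.card V)) hzero
  set l := Nat.findGreatest (fun l => ∃ f, IsInducedPath G X f l) (Fintype.card V)
  have hmax : ∀ f, ¬ IsInducedPath G X f (l + 1) := fun f hf' => by
    have : l + 1 ≤ l := Nat.le_findGreatest (P := fun l => ∃ f, IsInducedPath G X f l)
      (hbound _ ⟨f, hf'⟩) ⟨f, hf'⟩
    omega
  have hcol : ∀ i ≤ l, (c (f i) ↔ (c (f 0) ↔ Even i)) := by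
    intro i
    induction i with
    | zero => simp
    | succ i ih =>
      intro hi
      have h1 := ih (by omega)
      have h2 := hc _ (hf.1 (i + 1) hi) _ (hf.1 i (by omega))
        ((hf.2.2 _ hi _ (by omega)).2 (Or.inr rfl))
      rw [Nat.even_add_one]
      tauto
  obtain ⟨u, huX, hu1, hu0⟩ := hdeg _ (hf.1 0 (by omega)) (f 1)
  have hunot : ∀ i ≤ l, f i ≠ u := by
    rintro i hi rfl
    have := (hf.2.2 _ (by omega) _ hi).1 hu0
    have : i = 1 := by omega
    exact hu1 (by rw [this])
  have hex : ∃ j, 1 ≤ j ∧ j ≤ l ∧ G.Adj u (f j) := by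
    by_contra hno
    push Not at hno
    apply hmax (fun i => if i = 0 then u else f (i - 1))
    refine ⟨?_, ?_, ?_⟩
    · intro i hi
      dsimp only
      split_ifs with h1
      · exact huX
      · exact hf.1 _ (by omega)
    · intro i hi j hj hij
      dsimp only at hij
      split_ifs at hij with h1 h2 h2
      · omega
      · exact absurd hij.symm (hunot _ (by omega))
      · exact absurd hij (hunot _ (by omega))
      · have := hf.2.1 _ (by omega) _ (by omega) hij
        omega
    · have hadj : ∀ i ≤ l, G.Adj u (f i) ↔ i = 0 := by
        intro i hi
        constructor
        · intro h
          by_contra h0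
          exact hno i (by omega) hi h
        · rintro rfl
          exact hu0.symm
      intro i hi j hj
      dsimp only
      split_ifs with h1 h2 h2
      · simp only [SimpleGraph.irrefl, false_iff]
        omega
      · rw [hadj _ (by omega)]
        omega
      · rw [G.adj_comm, hadj _ (by omega)]
        omega
      · rw [hf.2.2 _ (by omega) _ (by omega)]
        omega
  have hspec := Nat.find_spec hex
  have hmin : ∀ i, 1 ≤ i → i ≤ l → G.Adj u (f i) → Nat.find hex ≤ i :=
    fun i h1 h2 h3 => Nat.find_min' hex ⟨h1, h2, h3⟩
  set j := Nat.find hex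
  obtain ⟨hj1, hjl, huj⟩ := hspec
  refine ⟨j + 2, ?_, IsInducedPath.hasChordlessCycle (X := X) (f := f) (u := u)
    ⟨fun i hi => hf.1 i (hi.trans hjl),
      fun a ha b hb => hf.2.1 a (ha.trans hjl) b (hb.trans hjl),
      fun a ha b hb => hf.2.2 a (ha.trans hjl) b (hb.trans hjl)⟩ hj1
    (fun i hi => hunot i (hi.trans hjl)) ?_⟩
  · have h1 := hcol j hjl
    have h2 := hc _ huX _ (hf.1 j hjl) huj
    have h3 := hc _ huX _ (hf.1 0 (by omega)) hu0.symm
    have : Even j := by tauto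
    exact this.add (by decide)
  · intro i hi
    constructor
    · intro h
      by_contra hne
      have := hmin i (by omega) (by omega) h
      omega
    · rintro (rfl | rfl)
      · exact hu0.symm
      · exact huj

/-- If `G` has no chordless even cycle, then between two disjoint nonempty independent sets there
is a vertex with at most one neighbour in the other set. -/
lemma exists_le_one_neighbor [Finite V] {G : SimpleGraph V}
    (h : ∀ m : ℕ, Even m → ¬ HasChordlessCycle G m) {A B : Finset V}
    (hA : A ∈ indepComplex G) (hB : B ∈ indepComplex G) (hAB : Disjoint A B)
    (hA₀ : A.Nonempty) (hB₀ : B.Nonempty) :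
    (∃ b ∈ B, ∃ a ∈ A, ∀ x ∈ A, x ≠ a → ¬ G.Adj b x) ∨
      ∃ a ∈ A, ∃ b ∈ B, ∀ x ∈ B, x ≠ b → ¬ G.Adj a x := by
  by_contra! hcon
  obtain ⟨h1, h2⟩ := hcon
  have hdisj : ∀ x, x ∈ A → x ∈ B → False := fun x h1 h2 =>
    Finset.disjoint_left.1 hAB h1 h2
  have step : ∀ {S T : Finset V}, T.Nonempty →
      (∀ b ∈ S, ∀ a ∈ T, ∃ x ∈ T, x ≠ a ∧ G.Adj b x) →
      ∀ x ∈ S, ∀ y, ∃ z ∈ T, z ≠ y ∧ G.Adj x z := by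
    intro S T hT hST x hx y
    by_cases hy : y ∈ T
    · exact hST x hx y hy
    · obtain ⟨t, ht⟩ := hT
      obtain ⟨z, hz, -, hxz⟩ := hST x hx t ht
      exact ⟨z, hz, fun hzy => hy (hzy ▸ hz), hxz⟩
  obtain ⟨m, hm, hcyc⟩ := exists_even_chordlessCycle (G := G) (X := {x | x ∈ A ∨ x ∈ B})
    (hA₀.imp fun _ => Or.inl) (fun x => x ∈ A) (by
      rintro x (hx | hx) y (hy | hy) hxy
      · exact absurd hxy (hA x hx y hy)
      · exact iff_of_true hx fun hy' => hdisj y hy' hy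
      · exact iff_of_false (fun hx' => hdisj x hx' hx) (by simpa using hy)
      · exact absurd hxy (hB x hx y hy)) (by
      rintro x (hx | hx) y
      · obtain ⟨z, hz, hzy⟩ := step hB₀ h2 x hx y
        exact ⟨z, Or.inr hz, hzy⟩
      · obtain ⟨z, hz, hzy⟩ := step hA₀ h1 x hx y
        exact ⟨z, Or.inl hz, hzy⟩)
  exact h m hm hcyc

variable [DecidableEq V]

/-- `S` and `T` are faces of `Δ` containing `σ`, and `T` is obtained from `S` by exchanging one
vertex. -/
def ExchangeStep (Δ : Set (Finset V)) (σ S T : Finset V) : Prop :=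
  S ∈ Δ ∧ T ∈ Δ ∧ σ ⊆ S ∧ σ ⊆ T ∧ ∃ a ∈ S, ∃ b ∉ S, T = insert b (S.erase a)

/-- `Δ` is strongly connected in every dimension and around every face: two faces with equally
many vertices are joined by single exchanges of vertices, keeping the common vertices. -/
def IsStronglyConnected (Δ : Set (Finset V)) : Prop :=
  ∀ σ S T : Finset V, S ∈ Δ → T ∈ Δ → S.card = T.card → σ ⊆ S → σ ⊆ T →
    Relation.ReflTransGen (ExchangeStep Δ σ) S T

lemma exchange_mem_indepComplex {G : SimpleGraph V} {A B : Finset V} (hA : A ∈ indepComplex G)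
    (hB : B ∈ indepComplex G) {a b : V} (hb : b ∈ B)
    (hab : ∀ x ∈ A \ B, x ≠ a → ¬ G.Adj b x) : insert b (A.erase a) ∈ indepComplex G := by
  have key : ∀ x ∈ A.erase a, ¬ G.Adj b x := by
    intro x hx
    rw [Finset.mem_erase] at hx
    by_cases hxB : x ∈ B
    · exact hB b hb x hxB
    · exact hab x (Finset.mem_sdiff.2 ⟨hx.2, hxB⟩) hx.1
  intro x hx y hy
  rw [Finset.mem_insert] at hx hy
  rcases hx with rfl | hx <;> rcases hy with rfl | hy
  · exact G.irrefl
  · exact key y hy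
  · exact fun hxy => key x hx hxy.symm
  · exact hA x (Finset.mem_of_mem_erase hx) y (Finset.mem_of_mem_erase hy)

theorem isStronglyConnected_indepComplex [Finite V] {G : SimpleGraph V}
    (h : ∀ m : ℕ, Even m → ¬ HasChordlessCycle G m) :
    IsStronglyConnected (indepComplex G) := by
  intro σ S T hS hT hcard hσS hσT
  induction hn : (S \ T).card generalizing S T with
  | zero =>
    have hsub : S ⊆ T := by simpa [Finset.sdiff_eq_empty_iff_subset] using hn
    rw [Finset.eq_of_subset_of_card_le hsub hcard.ge]
  | succ n ih =>
    have hcomm : (T \ S).card = n + 1 := by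
      rw [← hn]
      exact (Finset.card_sdiff_comm hcard).symm
    have hsub : ∀ {P Q : Finset V}, P ∈ indepComplex G → P \ Q ∈ indepComplex G :=
      fun hP x hx y hy => hP x (Finset.mem_sdiff.1 hx).1 y (Finset.mem_sdiff.1 hy).1
    rcases exists_le_one_neighbor h (hsub hS : S \ T ∈ _) (hsub hT : T \ S ∈ _)
      disjoint_sdiff_sdiff (Finset.card_pos.1 (by omega)) (Finset.card_pos.1 (by omega))
      with ⟨b, hb, a, ha, hab⟩ | ⟨a, ha, b, hb, hab⟩
    · rw [Finset.mem_sdiff] at ha hb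
      have hmem := exchange_mem_indepComplex hS hT hb.1 hab
      have hσ : σ ⊆ insert b (S.erase a) := fun x hx => Finset.mem_insert_of_mem
        (Finset.mem_erase.2 ⟨fun hxa => ha.2 (hxa ▸ hσT hx), hσS hx⟩)
      refine Relation.ReflTransGen.head
        ⟨hS, hmem, hσS, hσ, a, ha.1, b, hb.2, rfl⟩ (ih _ _ hmem hT ?_ hσ hσT ?_)
      · rw [← hcard, Finset.card_insert_of_notMem (fun hc => hb.2 (Finset.mem_of_mem_erase hc)),
          Finset.card_erase_add_one ha.1]
      · have : insert b (S.erase a) \ T = (S \ T).erase a := by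
          ext x
          simp only [Finset.mem_sdiff, Finset.mem_insert, Finset.mem_erase]
          constructor
          · rintro ⟨rfl | hx, hxT⟩
            · exact absurd hb.1 hxT
            · exact ⟨hx.1, hx.2, hxT⟩
          · rintro ⟨hx1, hx2, hx3⟩
            exact ⟨Or.inr ⟨hx1, hx2⟩, hx3⟩
        rw [this, Finset.card_erase_of_mem (Finset.mem_sdiff.2 ha), hn]
        rfl
    · rw [Finset.mem_sdiff] at ha hb
      have hmem := exchange_mem_indepComplex hT hS ha.1 hab
      have hσ : σ ⊆ insert a (T.erase b) := fun x hx => Finset.mem_insert_of_mem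
        (Finset.mem_erase.2 ⟨fun hxa => hb.2 (hxa ▸ hσS hx), hσT hx⟩)
      have hT' : T = insert b ((insert a (T.erase b)).erase a) := by
        rw [Finset.erase_insert (fun hc => ha.2 (Finset.mem_of_mem_erase hc)),
          Finset.insert_erase hb.1]
      refine Relation.ReflTransGen.tail (ih _ _ hS hmem ?_ hσS hσ ?_)
        ⟨hmem, hT, hσ, hσT, a, Finset.mem_insert_self _ _, b, ?_, hT'⟩
      · rw [hcard, Finset.card_insert_of_notMem (fun hc => ha.2 (Finset.mem_of_mem_erase hc)),
          Finset.card_erase_add_one hb.1]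
      · have : S \ insert a (T.erase b) = (S \ T).erase a := by
          ext x
          simp only [Finset.mem_sdiff, Finset.mem_insert, Finset.mem_erase]
          constructor
          · rintro ⟨hx, hxT⟩
            refine ⟨fun hxa => hxT (Or.inl hxa), hx, fun hxT' => hxT (Or.inr ⟨?_, hxT'⟩)⟩
            rintro rfl
            exact hb.2 hx
          · rintro ⟨hx1, hx2, hx3⟩
            refine ⟨hx2, ?_⟩
            rintro (hxa | hxT)
            · exact hx1 hxa
            · exact hx3 hxT.2
        rw [this, Finset.card_erase_of_mem (Finset.mem_sdiff.2 ha), hn]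
        rfl
      · simp only [Finset.mem_insert, Finset.mem_erase, ne_eq, not_true_eq_false, false_and,
          or_false]
        rintro rfl
        exact hb.2 ha.1

end Combinatorics

/-! ### The prime ideals of faces -/

section FaceIdeal

variable {V : Type*} (k : Type*) [Field k]

/-- The monomial prime generated by the variables outside `F`. -/
noncomputable def faceIdeal (F : Finset V) : Ideal (MvPolynomial V k) :=
  Ideal.span (X '' {v | v ∉ F})

variable {k}

lemma mem_faceIdeal {F : Finset V} {f : MvPolynomial V k} :
    f ∈ faceIdeal k F ↔ ∀ a : V →₀ ℕ, a.support ⊆ F → coeff a f = 0 := by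
  rw [faceIdeal, mem_ideal_span_X_image]
  refine forall_congr' fun a => ?_
  rw [mem_support_iff, ← not_imp_not (a := coeff a f = 0), Finset.not_subset]
  simp only [Set.mem_ofPred_eq, Finsupp.mem_support_iff]
  exact imp_congr_right fun _ => exists_congr fun _ => and_comm

lemma X_mem_faceIdeal {F : Finset V} {v : V} :
    (X v : MvPolynomial V k) ∈ faceIdeal k F ↔ v ∉ F := by
  rw [mem_faceIdeal]
  constructor
  · intro h hv
    have := h (Finsupp.single v 1)
      ((Finsupp.support_single_subset).trans (Finset.singleton_subset_iff.2 hv))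
    simp at this
  · intro hv a ha
    classical
    rw [coeff_X, if_neg]
    rintro rfl
    exact hv (ha (by simp))

lemma faceIdeal_le_iff {F F' : Finset V} : faceIdeal k F ≤ faceIdeal k F' ↔ F' ⊆ F := by
  constructor
  · intro h v hv
    by_contra hvF
    exact X_mem_faceIdeal.1 (h (X_mem_faceIdeal.2 hvF)) hv
  · intro h f hf
    rw [mem_faceIdeal] at hf ⊢
    exact fun a ha => hf a (ha.trans h)

lemma faceIdeal_erase [DecidableEq V] {F : Finset V} {a : V} :
    faceIdeal k (F.erase a) = faceIdeal k F ⊔ Ideal.span {X a} := by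
  apply le_antisymm
  · rw [faceIdeal, Ideal.span_le]
    rintro _ ⟨v, hv, rfl⟩
    by_cases hva : v = a
    · subst hva
      exact Ideal.mem_sup_right (Ideal.mem_span_singleton_self _)
    · refine Ideal.mem_sup_left (X_mem_faceIdeal.2 fun hvF => hv ?_)
      exact Finset.mem_erase.2 ⟨hva, hvF⟩
  · refine sup_le (faceIdeal_le_iff.2 (Finset.erase_subset _ _)) ?_
    rw [Ideal.span_singleton_le_iff_mem, X_mem_faceIdeal]
    exact Finset.notMem_erase a F

open Classical in
/-- Restriction of polynomials to the coordinate subspace of a face. -/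
noncomputable def restrictFace (F : Finset V) :
    MvPolynomial V k →ₐ[k] MvPolynomial F k :=
  aeval fun v => if h : v ∈ F then X ⟨v, h⟩ else 0

lemma restrictFace_X_of_mem {F : Finset V} {v : V} (h : v ∈ F) :
    restrictFace F (X v : MvPolynomial V k) = X ⟨v, h⟩ := by
  simp [restrictFace, h]

lemma restrictFace_X_of_notMem {F : Finset V} {v : V} (h : v ∉ F) :
    restrictFace F (X v : MvPolynomial V k) = 0 := by
  simp [restrictFace, h]

lemma restrictFace_rename (F : Finset V) (g : MvPolynomial F k) :
    restrictFace F (rename Subtype.val g) = g := by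
  rw [← AlgHom.comp_apply]
  conv_rhs => rw [← AlgHom.id_apply (R := k) g]
  congr 1
  ext i
  simp [restrictFace]

lemma restrictFace_surjective (F : Finset V) :
    Function.Surjective (restrictFace F : MvPolynomial V k →ₐ[k] MvPolynomial F k) :=
  fun g => ⟨_, restrictFace_rename F g⟩

lemma sub_rename_restrictFace_mem (F : Finset V) (f : MvPolynomial V k) :
    f - rename Subtype.val (restrictFace F f) ∈ faceIdeal k F := by
  rw [← Ideal.Quotient.mk_eq_mk_iff_sub_mem]
  change Ideal.Quotient.mkₐ k (faceIdeal k F) f =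
    ((Ideal.Quotient.mkₐ k (faceIdeal k F)).comp
      ((rename Subtype.val).comp (restrictFace F))) f
  congr 1
  ext v
  by_cases hv : v ∈ F
  · simp [restrictFace_X_of_mem hv]
  · simpa [restrictFace_X_of_notMem hv] using
      Ideal.Quotient.eq_zero_iff_mem.2 (X_mem_faceIdeal.2 hv)

lemma restrictFace_eq_zero_iff {F : Finset V} {f : MvPolynomial V k} :
    restrictFace F f = 0 ↔ f ∈ faceIdeal k F := by
  constructor
  · intro h
    simpa [h] using sub_rename_restrictFace_mem F f
  · intro h
    have : faceIdeal k F ≤ RingHom.ker (restrictFace F : MvPolynomial V k →ₐ[k] _) := by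
      rw [faceIdeal, Ideal.span_le]
      rintro _ ⟨v, hv, rfl⟩
      exact restrictFace_X_of_notMem hv
    exact this h

lemma ker_restrictFace (F : Finset V) :
    RingHom.ker (restrictFace F : MvPolynomial V k →ₐ[k] _) = faceIdeal k F :=
  Ideal.ext fun _ => restrictFace_eq_zero_iff

instance faceIdeal_isPrime (F : Finset V) : (faceIdeal k F).IsPrime := by
  rw [← ker_restrictFace]
  exact RingHom.ker_isPrime _

lemma ringKrullDim_quotient_faceIdeal (F : Finset V) :
    ringKrullDim (MvPolynomial V k ⧸ faceIdeal k F) = F.card := by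
  have e : (MvPolynomial V k ⧸ faceIdeal k F) ≃+* MvPolynomial F k :=
    (Ideal.quotEquivOfEq (ker_restrictFace F).symm).trans
      (RingHom.quotientKerEquivOfSurjective
        (f := (restrictFace F : MvPolynomial V k →ₐ[k] _).toRingHom) (restrictFace_surjective F))
  rw [ringKrullDim_eq_of_ringEquiv e, MvPolynomial.ringKrullDim_of_isNoetherianRing,
    ringKrullDim_eq_zero_of_field]
  simp

lemma faceIdeal_sup_span_isPrime {F : Finset V} {x : MvPolynomial V k}
    (hx : Prime (restrictFace F x)) : (faceIdeal k F ⊔ Ideal.span {x}).IsPrime := by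
  have h : faceIdeal k F ⊔ Ideal.span {x} =
      Ideal.comap (restrictFace F : MvPolynomial V k →ₐ[k] _)
        (Ideal.span {restrictFace F x}) := by
    rw [← Set.image_singleton (f := restrictFace F), ← Ideal.map_span,
      Ideal.comap_map_of_surjective _ (restrictFace_surjective F), sup_comm]
    congr 1
    exact (ker_restrictFace F).symm
  rw [h]
  have := (Ideal.span_singleton_prime hx.ne_zero).2 hx
  exact Ideal.comap_isPrime _ _

lemma prod_X_mem_faceIdeal {E F : Finset V} :
    (∏ i ∈ E, X i : MvPolynomial V k) ∈ faceIdeal k F ↔ ¬ E ⊆ F := by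
  rw [Ideal.IsPrime.prod_mem_iff, Finset.not_subset]
  simp [X_mem_faceIdeal]

/-- If `y` is not divisible by the prime element `x` on a face, then `x` and `y` have no common
zero divisors in codimension one. -/
lemma notMem_faceIdeal_erase [DecidableEq V] {F : Finset V} {x y : MvPolynomial V k} {a : V}
    (hx : x ∉ faceIdeal k F) (hp : (faceIdeal k F ⊔ Ideal.span {x}).IsPrime)
    (hy : y ∉ faceIdeal k F ⊔ Ideal.span {x}) (hxa : x ∈ faceIdeal k (F.erase a)) :
    y ∉ faceIdeal k (F.erase a) := by
  rw [faceIdeal_erase] at hxa ⊢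
  suffices hX : X a ∈ faceIdeal k F ⊔ Ideal.span {x} from fun hya =>
    hy (sup_le le_sup_left ((Ideal.span_singleton_le_iff_mem _).2 hX) hya)
  obtain ⟨c, hc⟩ : ∃ c, x - c * X a ∈ faceIdeal k F := by
    obtain ⟨u, hu, w, hw, rfl⟩ := Submodule.mem_sup.1 hxa
    obtain ⟨c, rfl⟩ := Ideal.mem_span_singleton'.1 hw
    exact ⟨c, by simpa using hu⟩
  have hcX : c * X a ∈ faceIdeal k F ⊔ Ideal.span {x} := by
    have := Ideal.sub_mem _ (Ideal.mem_sup_right (Ideal.mem_span_singleton_self x))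
      (Ideal.mem_sup_left (T := Ideal.span {x}) hc)
    simpa using this
  refine (hp.mem_or_mem hcX).resolve_left fun hcQ => ?_
  obtain ⟨u, hu, w, hw, rfl⟩ := Submodule.mem_sup.1 hcQ
  obtain ⟨c', rfl⟩ := Ideal.mem_span_singleton'.1 hw
  have h1 : x * (1 - c' * X a) ∈ faceIdeal k F := by
    have := Ideal.add_mem _ hc (Ideal.mul_mem_right (X a) _ hu)
    convert this using 1
    ring
  have h2 := (faceIdeal_isPrime F).mem_or_mem h1 |>.resolve_left hx
  rw [mem_faceIdeal] at h2
  have := h2 0 (by simp)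
  simp [coeff_mul_X'] at this

end FaceIdeal

/-! ### The dimension filtration -/

section DimFiltration

variable {V : Type*} (k : Type*) [Field k]

/-- The ideal of the subcomplex generated by the facets of `Δ` with at least `d` vertices. -/
noncomputable def dimFiltration (Δ : Set (Finset V)) (d : ℕ) : Ideal (MvPolynomial V k) :=
  ⨅ F : {F : Finset V // IsFacet Δ F ∧ d ≤ F.card}, faceIdeal k F.1

variable {k} {Δ : Set (Finset V)} {d : ℕ}

lemma mem_dimFiltration {f : MvPolynomial V k} :
    f ∈ dimFiltration k Δ d ↔ ∀ F, IsFacet Δ F → d ≤ F.card → f ∈ faceIdeal k F := by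
  simp [dimFiltration]

lemma mem_dimFiltration_succ {f : MvPolynomial V k} :
    f ∈ dimFiltration k Δ d ↔ f ∈ dimFiltration k Δ (d + 1) ∧
      ∀ F, IsFacet Δ F → F.card = d → f ∈ faceIdeal k F := by
  simp only [mem_dimFiltration]
  constructor
  · exact fun h => ⟨fun F hF hd => h F hF (by omega), fun F hF hd => h F hF hd.ge⟩
  · rintro ⟨h1, h2⟩ F hF hd
    rcases hd.eq_or_lt with hd | hd
    · exact h2 F hF hd.symm
    · exact h1 F hF hd

lemma dimFiltration_le_succ : dimFiltration k Δ d ≤ dimFiltration k Δ (d + 1) :=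
  fun _ hf => (mem_dimFiltration_succ.1 hf).1

lemma isHomogeneousIdeal_dimFiltration : IsHomogeneousIdeal k (dimFiltration k Δ d) := by
  intro f hf i
  rw [mem_dimFiltration] at hf ⊢
  intro F hF hd
  have := hf F hF hd
  rw [mem_faceIdeal] at this ⊢
  intro a ha
  rw [coeff_homogeneousComponent, this a ha, ite_self]

lemma exists_facet_superset [Finite V] {F : Finset V} (hF : F ∈ Δ) :
    ∃ G, IsFacet Δ G ∧ F ⊆ G := by
  obtain ⟨G, hFG, hG⟩ := (Set.toFinite Δ).exists_le_maximal hF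
  exact ⟨G, ⟨hG.prop, fun H hH hGH => hG.eq_of_le hH hGH⟩, hFG⟩

lemma dimFiltration_zero [Finite V] (hΔ : IsComplex Δ) :
    dimFiltration k Δ 0 = srIdeal k Δ := by
  classical
  have hspan : srIdeal k Δ = Ideal.span ((fun s => monomial s (1 : k)) ''
      {s | ∃ F : Finset V, F ∉ Δ ∧ s = ∑ i ∈ F, Finsupp.single i 1}) := by
    rw [srIdeal]
    congr 1
    ext m
    have hprod : ∀ F : Finset V, (∏ i ∈ F, X i : MvPolynomial V k) =
        monomial (∑ i ∈ F, Finsupp.single i 1) 1 := fun F => by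
      rw [monomial_sum_one]
      rfl
    simp only [Set.mem_ofPred_eq, Set.mem_image]
    constructor
    · rintro ⟨F, hF, rfl⟩
      exact ⟨_, ⟨F, hF, rfl⟩, (hprod F).symm⟩
    · rintro ⟨_, ⟨F, hF, rfl⟩, rfl⟩
      exact ⟨F, hF, (hprod F).symm⟩
  have hle : ∀ (F : Finset V) (a : V →₀ ℕ),
      ∑ i ∈ F, Finsupp.single i 1 ≤ a ↔ F ⊆ a.support := by
    intro F a
    simp only [Finsupp.le_def, Finsupp.coe_finsetSum, Finset.sum_apply, Finsupp.single_apply,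
      Finset.sum_ite_eq', Finset.subset_iff, Finsupp.mem_support_iff]
    refine forall_congr' fun i => ?_
    split_ifs with h <;> simp [h, Nat.one_le_iff_ne_zero]
  ext f
  rw [hspan, mem_ideal_span_monomial_image, mem_dimFiltration]
  constructor
  · intro h a ha
    refine ⟨_, ⟨a.support, fun hmem => ?_, rfl⟩, (hle _ _).2 subset_rfl⟩
    obtain ⟨G, hG, haG⟩ := exists_facet_superset hmem
    exact mem_support_iff.1 ha (mem_faceIdeal.1 (h G hG (Nat.zero_le _)) a haG)
  · intro h F hF _
    rw [mem_faceIdeal]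
    intro a ha
    by_contra hne
    obtain ⟨_, ⟨E, hE, rfl⟩, hEa⟩ := h a (mem_support_iff.2 hne)
    exact hE (hΔ F hF.1 E (((hle _ _).1 hEa).trans ha))

lemma dimFiltration_eq_top (h : ∀ F ∈ Δ, F.card < d) : dimFiltration k Δ d = ⊤ := by
  rw [eq_top_iff]
  intro f _
  rw [mem_dimFiltration]
  exact fun F hF hd => absurd (h F hF.1) (by omega)

lemma exists_facet_of_dimFiltration_ne
    (h : dimFiltration k Δ d ≠ dimFiltration k Δ (d + 1)) : ∃ F, IsFacet Δ F ∧ F.card = d := by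
  by_contra! hno
  exact h (Ideal.ext fun f => mem_dimFiltration_succ.trans
    (and_iff_left fun F hF hd => absurd hd (hno F hF)))

/-- In a strongly connected complex, polynomials on the `d`-vertex faces which agree in
codimension one, and vanish on faces that are not facets, are induced by one polynomial. -/
theorem exists_glue [Fintype V] [DecidableEq V] (hΔ : IsComplex Δ) (hsc : IsStronglyConnected Δ)
    (f : Finset V → MvPolynomial V k)
    (hzero : ∀ F ∈ Δ, F.card = d → ¬ IsFacet Δ F → f F = 0)
    (hcompat : ∀ F ∈ Δ, ∀ F' ∈ Δ, F.card = d → F'.card = d →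
      ∀ a ∈ F, ∀ b ∉ F, F' = insert b (F.erase a) → f F - f F' ∈ faceIdeal k (F.erase a)) :
    ∃ g ∈ dimFiltration k Δ (d + 1),
      ∀ F ∈ Δ, F.card = d → g - f F ∈ faceIdeal k F := by
  classical
  have hprop : ∀ (a : V →₀ ℕ) (S T : Finset V), S ∈ Δ → T ∈ Δ → S.card = d → T.card = d →
      a.support ⊆ S → a.support ⊆ T → coeff a (f S) = coeff a (f T) := by
    intro a S T hS hT hSd hTd haS haT
    have hchain := hsc a.support S T hS hT (hSd.trans hTd.symm) haS haT
    suffices h : T.card = d ∧ coeff a (f S) = coeff a (f T) from h.2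
    clear hTd hT haT
    induction hchain with
    | refl => exact ⟨hSd, rfl⟩
    | @tail P Q _ hstep ih =>
      obtain ⟨hP, hQ, haP, haQ, v, hv, w, hw, hQP⟩ := hstep
      have hQd : Q.card = d := by
        rw [hQP, Finset.card_insert_of_notMem (fun hc => hw (Finset.mem_of_mem_erase hc)),
          Finset.card_erase_add_one hv, ih.1]
      refine ⟨hQd, ih.2.trans ?_⟩
      have hmem := hcompat P hP Q hQ ih.1 hQd v hv w hw hQP
      rw [← sub_eq_zero, ← coeff_sub]
      refine mem_faceIdeal.1 hmem a fun z hz => Finset.mem_erase.2 ⟨?_, haP hz⟩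
      rintro rfl
      have hzQ := haQ hz
      rw [hQP, Finset.mem_insert] at hzQ
      rcases hzQ with rfl | hzQ
      · exact hw hv
      · exact Finset.notMem_erase _ _ hzQ
  let c : (V →₀ ℕ) → k := fun a =>
    if h : ∃ F ∈ Δ, F.card = d ∧ a.support ⊆ F then coeff a (f h.choose) else 0
  have hc : ∀ F ∈ Δ, F.card = d → ∀ a : V →₀ ℕ, a.support ⊆ F → c a = coeff a (f F) := by
    intro F hF hd a ha
    have h : ∃ F ∈ Δ, F.card = d ∧ a.support ⊆ F := ⟨F, hF, hd, ha⟩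
    simp only [c, dif_pos h]
    exact hprop a _ F h.choose_spec.1 hF h.choose_spec.2.1 hd h.choose_spec.2.2 ha
  let U : Finset (V →₀ ℕ) := Finset.univ.biUnion fun F => (f F).support
  have hcU : ∀ a ∉ U, c a = 0 := by
    intro a ha
    simp only [c]
    split_ifs with h
    · by_contra hne
      exact ha (Finset.mem_biUnion.2 ⟨_, Finset.mem_univ _, mem_support_iff.2 hne⟩)
    · rfl
  have hg : ∀ a, coeff a (∑ b ∈ U, monomial b (c b)) = c a := by
    intro a
    rw [coeff_sum]
    simp only [coeff_monomial, Finset.sum_ite_eq']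
    split_ifs with h
    · rfl
    · exact (hcU a h).symm
  refine ⟨∑ b ∈ U, monomial b (c b), ?_, ?_⟩
  · rw [mem_dimFiltration]
    intro G hG hGd
    rw [mem_faceIdeal]
    intro a ha
    rw [hg]
    by_cases had : a.support.card ≤ d
    · obtain ⟨F, haF, hFG, hFd⟩ := Finset.exists_subsuperset_card_eq ha had (by omega)
      have hF : F ∈ Δ := hΔ G hG.1 F hFG
      rw [hc F hF hFd a haF, hzero F hF hFd, coeff_zero]
      intro hfacet
      have := hfacet.2 G hG.1 hFG
      rw [← this] at hGd
      omega
    · simp only [c]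
      rw [dif_neg]
      rintro ⟨F, hF, hFd, haF⟩
      exact had (hFd ▸ Finset.card_le_card haF)
  · intro F hF hd
    rw [mem_faceIdeal]
    intro a ha
    rw [coeff_sub, hg, hc F hF hd a ha, sub_self]

end DimFiltration

/-! ### Dimension and depth of localized modules -/

section Localization

lemma ringKrullDim_quotient_le {B : Type*} [CommRing B] {I : Ideal B} {n : WithBot ℕ∞}
    (h : ∀ Q : Ideal B, Q.IsPrime → I ≤ Q → ∃ K ≤ Q, ringKrullDim (B ⧸ K) ≤ n) :
    ringKrullDim (B ⧸ I) ≤ n := by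
  rw [ringKrullDim_quotient, Order.krullDim]
  refine iSup_le fun l => ?_
  obtain ⟨K, hK, hdim⟩ := h l.head.1.asIdeal l.head.1.2 l.head.2
  rw [ringKrullDim_quotient] at hdim
  refine le_trans ?_ hdim
  let l' : LTSeries (PrimeSpectrum.zeroLocus (K : Set B)) :=
    { length := l.length
      toFun := fun i => ⟨(l i).1, fun x hx =>
        (show l.head.1 ≤ (l i).1 from LTSeries.head_le l i) (hK hx)⟩
      step := fun i => l.step i }
  exact Order.LTSeries.length_le_krullDim l'

variable {A : Type*} [CommRing A]

lemma localizedModule_mk_eq_zero_iff {M : Type*} [AddCommGroup M] [Module A M] {S : Submonoid A}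
    {m : M} {s : S} : LocalizedModule.mk m s = 0 ↔ ∃ t ∈ S, t • m = 0 := by
  rw [← LocalizedModule.zero_mk 1, LocalizedModule.mk_eq]
  simp [Submonoid.smul_def]

lemma isSMulRegular_localizedModule {M : Type*} [AddCommGroup M] [Module A M] {S : Submonoid A}
    {x : A} (h : ∀ m : M, ∀ s ∈ S, s • x • m = 0 → ∃ t ∈ S, t • m = 0) :
    IsSMulRegular (LocalizedModule S M) (algebraMap A (Localization S) x) := by
  rw [isSMulRegular_iff_right_eq_zero_of_smul]
  intro z
  induction z using LocalizedModule.induction_on with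
  | h m s =>
    intro hz
    rw [algebraMap_smul, LocalizedModule.smul'_mk, localizedModule_mk_eq_zero_iff] at hz
    obtain ⟨u, hu, hum⟩ := hz
    exact localizedModule_mk_eq_zero_iff.2 (h m u hu hum)

lemma isSMulRegular_quotSMulTop_localizedModule {M : Type*} [AddCommGroup M] [Module A M]
    {S : Submonoid A} {x y : A}
    (h : ∀ m m' : M, ∀ s ∈ S, s • y • m = x • m' → ∃ t ∈ S, ∃ m'' : M, t • m = x • m'') :
    IsSMulRegular (QuotSMulTop (algebraMap A (Localization S) x) (LocalizedModule S M))
      (algebraMap A (Localization S) y) := by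
  refine (isSMulRegular_quotient_iff_mem_of_smul_mem _ _).2 fun z => ?_
  induction z using LocalizedModule.induction_on with
  | h m s =>
    intro hz
    obtain ⟨w, -, hw⟩ := (Submodule.mem_smul_pointwise_iff_exists _ _ _).1 hz
    induction w using LocalizedModule.induction_on with
    | h m' s' =>
      rw [algebraMap_smul, algebraMap_smul, LocalizedModule.smul'_mk, LocalizedModule.smul'_mk,
        LocalizedModule.mk_eq] at hw
      obtain ⟨u, hu⟩ := hw
      simp only [Submonoid.smul_def] at hu
      obtain ⟨t, ht, m'', hm⟩ := h m ((u * s : A) • m') (u * s') (S.mul_mem u.2 s'.2) (by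
        rw [mul_smul, ← hu, mul_smul, smul_comm x, smul_comm x])
      refine (Submodule.mem_smul_pointwise_iff_exists _ _ _).2
        ⟨LocalizedModule.mk m'' (⟨t, ht⟩ * s), trivial, ?_⟩
      rw [algebraMap_smul, LocalizedModule.smul'_mk, ← hm, LocalizedModule.mk_eq]
      exact ⟨1, by simp only [Submonoid.smul_def, one_smul, mul_smul]
                   rw [smul_comm]⟩

variable {p : Ideal A} [p.IsPrime]

lemma le_depthIn_localizedModule [IsNoetherianRing A] {M : Type*} [AddCommGroup M] [Module A M]
    [Module.Finite A M] [Nontrivial (LocalizedModule p.primeCompl M)] {rs : List A}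
    (hrs : ∀ x ∈ rs, x ∈ p)
    (hreg : RingTheory.Sequence.IsWeaklyRegular (LocalizedModule p.primeCompl M)
      (rs.map (algebraMap A (Localization p.primeCompl)))) :
    (rs.length : ℕ∞) ≤ depthIn (Localization p.primeCompl)
      (Ideal.map (algebraMap A (Localization p.primeCompl)) p)
      (LocalizedModule p.primeCompl M) := by
  refine le_sSup ⟨rs.map (algebraMap A (Localization p.primeCompl)), ?_, ?_, by simp⟩
  · intro z hz
    obtain ⟨x, hx, rfl⟩ := List.mem_map.1 hz
    exact Ideal.mem_map_of_mem _ (hrs x hx)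
  · refine RingTheory.Sequence.IsRegular.of_isWeaklyRegular_of_mem_maximalIdeal _ ?_ hreg
    intro z hz
    obtain ⟨x, hx, rfl⟩ := List.mem_map.1 hz
    rw [← Localization.AtPrime.map_eq_maximalIdeal]
    exact Ideal.mem_map_of_mem _ (hrs x hx)

/-- Krull's height theorem for a localization modulo an ideal. -/
lemma ringKrullDim_localization_quotient_le [IsNoetherianRing A] {K : Ideal A} {s : Set A}
    (hs : s.Finite) (hp : p = K ⊔ Ideal.span s) :
    ringKrullDim (Localization p.primeCompl ⧸
      K.map (algebraMap A (Localization p.primeCompl))) ≤ s.ncard := by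
  set B := Localization p.primeCompl
  set KB := K.map (algebraMap A B)
  have hKB : KB ≤ IsLocalRing.maximalIdeal B := by
    rw [← Localization.AtPrime.map_eq_maximalIdeal]
    exact Ideal.map_mono (hp ▸ le_sup_left)
  have : Nontrivial (B ⧸ KB) := Ideal.Quotient.nontrivial_iff.2
    fun h => Ideal.IsPrime.ne_top' (top_le_iff.1 (h ▸ hKB))
  have : IsLocalRing (B ⧸ KB) :=
    IsLocalRing.of_surjective' (Ideal.Quotient.mk KB) Ideal.Quotient.mk_surjective
  let φ : A →+* B ⧸ KB := (Ideal.Quotient.mk KB).comp (algebraMap A B)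
  have hmax : IsLocalRing.maximalIdeal (B ⧸ KB) = Ideal.span (φ '' s) := by
    have h1 : IsLocalRing.maximalIdeal (B ⧸ KB) =
        (IsLocalRing.maximalIdeal B).map (Ideal.Quotient.mk KB) := by
      refine (IsLocalRing.eq_maximalIdeal ?_).symm
      rcases Ideal.map_eq_top_or_isMaximal_of_surjective (Ideal.Quotient.mk KB)
        Ideal.Quotient.mk_surjective (IsLocalRing.maximalIdeal.isMaximal B) with h | h
      · exfalso
        have h2 := congrArg (Ideal.comap (Ideal.Quotient.mk KB)) h
        rw [Ideal.comap_map_of_surjective _ Ideal.Quotient.mk_surjective, ← RingHom.ker_eq_comap_bot,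
          Ideal.mk_ker, sup_eq_left.2 hKB, Ideal.comap_top] at h2
        exact Ideal.IsPrime.ne_top' h2
      · exact h
    have h2 : p.map φ = (K ⊔ Ideal.span s).map φ := congrArg (Ideal.map φ) hp
    rw [h1, ← Localization.AtPrime.map_eq_maximalIdeal, Ideal.map_map]
    refine h2.trans ?_
    rw [Ideal.map_sup, Ideal.map_span, ← Ideal.map_map, Ideal.map_quotient_self, bot_sup_eq]
  refine (ringKrullDim_le_spanFinrank_maximalIdeal (B ⧸ KB)).trans ?_
  rw [hmax]
  have h1 := Submodule.spanFinrank_span_le_ncard_of_finite (R := B ⧸ KB) (hs.image φ)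
  exact_mod_cast h1.trans (Set.ncard_image_le hs)

end Localization

/-! ### Elements in general position with respect to faces -/

section GeneralPosition

variable {V : Type*} {k : Type*} [Field k]

lemma prime_restrictFace_sum_X {F W : Finset V} (h : ∃ v ∈ F, v ∈ W) :
    Prime (restrictFace F (∑ v ∈ W, X v : MvPolynomial V k)) := by
  classical
  let c : F →₀ k := Finsupp.equivFunOnFinite.symm fun i => if i.1 ∈ W then 1 else 0
  have hc : restrictFace F (∑ v ∈ W, X v : MvPolynomial V k) = sumSMulX c := by
    rw [sumSMulX, Finsupp.linearCombination_apply, Finsupp.sum_fintype _ _ (by simp), map_sum]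
    have h1 : ∀ i : F, c i • (X i : MvPolynomial F k) =
        if i.1 ∈ W then restrictFace F (X i.1 : MvPolynomial V k) else 0 := by
      intro i
      rw [restrictFace_X_of_mem i.2]
      by_cases hi : i.1 ∈ W <;> simp [c, hi]
    rw [Finset.sum_congr rfl fun i _ => h1 i, Finset.sum_coe_sort F fun v =>
      if v ∈ W then restrictFace F (X v : MvPolynomial V k) else 0, ← Finset.sum_filter,
      Finset.filter_mem_eq_inter, Finset.inter_comm, ← Finset.filter_mem_eq_inter]
    refine (Finset.sum_filter_of_ne fun v _ hv => ?_).symm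
    by_contra hvF
    exact hv (restrictFace_X_of_notMem hvF)
  obtain ⟨v, hvF, hvW⟩ := h
  have hcv : c ⟨v, hvF⟩ = 1 := by simp [c, hvW]
  rw [hc]
  refine (irreducible_sumSMulX c ?_ fun r hr => ?_).prime
  · exact ⟨⟨v, hvF⟩, by simp [hcv]⟩
  · exact isUnit_of_dvd_one (hcv ▸ hr ⟨v, hvF⟩)

lemma faceIdeal_le_of_forall_X_mem {T : Finset V} {p : Ideal (MvPolynomial V k)}
    (h : ∀ v ∉ T, X v ∈ p) : faceIdeal k T ≤ p := by
  rw [faceIdeal, Ideal.span_le]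
  rintro _ ⟨v, hv, rfl⟩
  exact h v hv

lemma eq_of_X_mem_faceIdeal_sup_span_sum [DecidableEq V] {F W : Finset V} {v v' : V}
    (hv : v ∈ F) (hv' : v' ∈ F) (hvW : v ∈ W) (hvW' : v' ∈ W)
    (h : X v ∈ faceIdeal k F ⊔ Ideal.span {∑ w ∈ W, X w}) : v = v' := by
  by_contra hne
  let φ : MvPolynomial V k →+* k := eval (Pi.single v 1 - Pi.single v' 1)
  have hle : faceIdeal k F ⊔ Ideal.span {∑ w ∈ W, X w} ≤ RingHom.ker φ := by
    refine sup_le (faceIdeal_le_of_forall_X_mem fun w hw => ?_)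
      ((Ideal.span_singleton_le_iff_mem _).2 ?_)
    · have h1 : w ≠ v := fun h => hw (h ▸ hv)
      have h2 : w ≠ v' := fun h => hw (h ▸ hv')
      simp [φ, RingHom.mem_ker, h1, h2]
    · simp [φ, RingHom.mem_ker, hvW, hvW', Finset.sum_pi_single']
  have := hle h
  simp [φ, RingHom.mem_ker, hne] at this

theorem exists_general_elements [Fintype V] {p : Ideal (MvPolynomial V k)} [p.IsPrime]
    {S : Set (Finset V)} {d : ℕ} (hcard : ∀ F ∈ S, F.card = d)
    (hle : ∀ F ∈ S, faceIdeal k F ≤ p) (hne : ∀ F ∈ S, faceIdeal k F ≠ p) :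
    ∃ x ∈ p, (∀ F ∈ S, x ∉ faceIdeal k F ∧ (faceIdeal k F ⊔ Ideal.span {x}).IsPrime) ∧
      ((∃ y ∈ p, ∀ F ∈ S, y ∉ faceIdeal k F ⊔ Ideal.span {x}) ∨
        ∀ F ∈ S, p = faceIdeal k F ⊔ Ideal.span {x}) := by
  classical
  suffices H : ∃ x ∈ p, (∀ F ∈ S, Prime (restrictFace F x)) ∧
      ((∃ y ∈ p, ∀ F ∈ S, y ∉ faceIdeal k F ⊔ Ideal.span {x}) ∨
        ∀ F ∈ S, p = faceIdeal k F ⊔ Ideal.span {x}) by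
    obtain ⟨x, hxp, hx, h⟩ := H
    exact ⟨x, hxp, fun F hF => ⟨fun hxF => (hx F hF).ne_zero (restrictFace_eq_zero_iff.2 hxF),
      faceIdeal_sup_span_isPrime (hx F hF)⟩, h⟩
  let W : Finset V := Finset.univ.filter fun v => X v ∈ p
  have hW : ∀ v, v ∈ W ↔ X v ∈ p := fun v => by simp [W]
  have hWF : ∀ F ∈ S, ∀ v ∉ W, v ∈ F := by
    intro F hF v hv
    by_contra hvF
    exact hv ((hW v).2 (hle F hF (X_mem_faceIdeal.2 hvF)))
  by_cases hT : ∃ F ∈ S, ∀ v ∈ F, v ∉ W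
  · obtain ⟨F, hF, hFW⟩ := hT
    have hS : ∀ F' ∈ S, F' = F := fun F' hF' =>
      (Finset.eq_of_subset_of_card_le (fun v hv => hWF F' hF' v (hFW v hv))
        (by rw [hcard F hF, hcard F' hF'])).symm
    let φ : MvPolynomial V k →+* MvPolynomial F k := (restrictFace F).toRingHom
    have hφ : Function.Surjective φ := restrictFace_surjective F
    have hker : RingHom.ker φ = faceIdeal k F := ker_restrictFace F
    have hprime : (p.map φ).IsPrime :=
      Ideal.map_isPrime_of_surjective hφ (hker.trans_le (hle F hF))
    have hbot : p.map φ ≠ ⊥ := by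
      rw [Ne, Ideal.map_eq_bot_iff_le_ker, hker]
      exact fun h => hne F hF (le_antisymm (hle F hF) h)
    obtain ⟨g, hg, hgp⟩ := hprime.exists_mem_prime_of_ne_bot hbot
    have hres : restrictFace F (rename Subtype.val g) = g := restrictFace_rename F g
    have hxp : rename Subtype.val g ∈ p := by
      obtain ⟨z, hz, hzg⟩ := (Ideal.mem_map_iff_of_surjective φ hφ).1 hg
      have h1 : z - rename Subtype.val g ∈ faceIdeal k F := by
        rw [← restrictFace_eq_zero_iff, map_sub, hres, sub_eq_zero]
        exact hzg
      exact (Submodule.sub_mem_iff_right p hz).1 (hle F hF h1)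
    refine ⟨rename Subtype.val g, hxp, fun F' hF' => ?_, ?_⟩
    · obtain rfl := hS F' hF'
      rwa [hres]
    · by_cases hp : p ≤ faceIdeal k F ⊔ Ideal.span {rename Subtype.val g}
      · refine Or.inr fun F' hF' => ?_
        obtain rfl := hS F' hF'
        exact le_antisymm hp
          (sup_le (hle F' hF) ((Ideal.span_singleton_le_iff_mem _).2 hxp))
      · obtain ⟨y, hy, hyF⟩ := SetLike.not_le_iff_exists.1 hp
        refine Or.inl ⟨y, hy, fun F' hF' => ?_⟩
        obtain rfl := hS F' hF'
        exact hyF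
  · push Not at hT
    have hprime : ∀ F ∈ S, Prime (restrictFace F (∑ v ∈ W, X v : MvPolynomial V k)) :=
      fun F hF => prime_restrictFace_sum_X (hT F hF)
    refine ⟨∑ v ∈ W, X v, p.sum_mem fun v hv => (hW v).1 hv, hprime, ?_⟩
    rw [or_iff_not_imp_left]
    intro hy
    push Not at hy
    have hcover : (p : Set (MvPolynomial V k)) ⊆ ⋃ F ∈ (↑(Set.toFinite S).toFinset : Set (Finset V)),
        ((faceIdeal k F ⊔ Ideal.span {∑ v ∈ W, X v} : Ideal (MvPolynomial V k)) :
          Set (MvPolynomial V k)) := by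
      intro y hyp
      obtain ⟨F, hF, hyF⟩ := hy y hyp
      simp only [Set.mem_iUnion]
      exact ⟨F, by simpa using hF, hyF⟩
    obtain ⟨F, hF, hpF⟩ := (Ideal.subset_union_prime (f := fun F =>
      faceIdeal k F ⊔ Ideal.span {∑ v ∈ W, X v}) ∅ ∅ fun F hF _ _ =>
        faceIdeal_sup_span_isPrime (hprime F (by simpa using hF))).1 hcover
    replace hF : F ∈ S := by simpa using hF
    have key : ∀ F' ∈ S, ∀ v ∈ F', v ∈ W → F'.erase v = Wᶜ →
        faceIdeal k F' ⊔ Ideal.span {∑ w ∈ W, X w} = faceIdeal k Wᶜ := by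
      intro F' hF' v hv hvW h
      rw [← h, faceIdeal_erase]
      have hsub : (∑ w ∈ W, X w : MvPolynomial V k) - X v ∈ faceIdeal k F' := by
        rw [← Finset.add_sum_erase W _ hvW, add_sub_cancel_left]
        refine Ideal.sum_mem _ fun w hw => X_mem_faceIdeal.2 fun hwF => ?_
        have : w ∈ Wᶜ := h ▸ Finset.mem_erase.2 ⟨(Finset.mem_erase.1 hw).1, hwF⟩
        exact Finset.mem_compl.1 this (Finset.mem_erase.1 hw).2
      refine le_antisymm (sup_le le_sup_left ((Ideal.span_singleton_le_iff_mem _).2 ?_))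
        (sup_le le_sup_left ((Ideal.span_singleton_le_iff_mem _).2 ?_))
      · rw [← sub_add_cancel (∑ w ∈ W, X w : MvPolynomial V k) (X v)]
        exact add_mem (Ideal.mem_sup_left hsub)
          (Ideal.mem_sup_right (Ideal.mem_span_singleton_self _))
      · rw [← sub_sub_cancel (∑ w ∈ W, X w : MvPolynomial V k) (X v)]
        exact sub_mem (Ideal.mem_sup_right (Ideal.mem_span_singleton_self _))
          (Ideal.mem_sup_left hsub)
    obtain ⟨v, hv, hvW⟩ := hT F hF
    have hFe : F.erase v = Wᶜ := by
      ext w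
      rw [Finset.mem_erase, Finset.mem_compl]
      constructor
      · rintro ⟨hwv, hwF⟩ hwW
        exact hwv (eq_of_X_mem_faceIdeal_sup_span_sum hwF hv hwW hvW (hpF ((hW w).1 hwW)))
      · exact fun hw => ⟨fun h => hw (h ▸ hvW), hWF F hF w hw⟩
    have hp : p = faceIdeal k Wᶜ := le_antisymm (hpF.trans (key F hF v hv hvW hFe).le)
      (faceIdeal_le_of_forall_X_mem fun w hw => (hW w).1 (by simpa using hw))
    intro F' hF'
    obtain ⟨v', hv', hvW'⟩ := hT F' hF'
    rw [key F' hF' v' hv' hvW' ?_, hp]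
    refine (Finset.eq_of_subset_of_card_le (fun w hw => ?_) ?_).symm
    · rw [Finset.mem_compl] at hw
      exact Finset.mem_erase.2 ⟨fun h => hw (h ▸ hvW'), hWF F' hF' w hw⟩
    · rw [← hFe, Finset.card_erase_of_mem hv, Finset.card_erase_of_mem hv', hcard F hF,
        hcard F' hF']

end GeneralPosition

/-! ### Serre's condition for the layers of the dimension filtration -/

section Layers

variable {V : Type*} {k : Type*} [Field k]

lemma exists_notMem_forall_mem_faceIdeal [Fintype V] (p : Ideal (MvPolynomial V k)) [p.IsPrime] :
    ∃ s ∉ p, ∀ F : Finset V, ¬ faceIdeal k F ≤ p → s ∈ faceIdeal k F := by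
  classical
  have h : ∀ F : Finset V, ∃ s ∉ p, ¬ faceIdeal k F ≤ p → s ∈ faceIdeal k F := by
    intro F
    by_cases hF : faceIdeal k F ≤ p
    · exact ⟨1, (Ideal.ne_top_iff_one p).1 Ideal.IsPrime.ne_top', fun h => absurd hF h⟩
    · obtain ⟨s, hs, hsp⟩ := SetLike.not_le_iff_exists.1 hF
      exact ⟨s, hsp, fun _ => hs⟩
  choose s hsp hs using h
  refine ⟨∏ F, s F, fun hmem => ?_, fun F hF => ?_⟩
  · obtain ⟨F, -, hF⟩ := Ideal.IsPrime.prod_mem_iff.1 hmem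
    exact hsp F hF
  · exact Ideal.mem_of_dvd _ (Finset.dvd_prod_of_mem s (Finset.mem_univ F)) (hs F hF)

variable {Δ : Set (Finset V)} {d : ℕ}

lemma mk_subquot_eq_zero_iff {A : Type*} [CommRing A] {J J' : Ideal A} {m : J'} :
    (Submodule.Quotient.mk m : subquot J J') = 0 ↔ (m : A) ∈ J := by
  rw [Submodule.Quotient.mk_eq_zero, Submodule.mem_comap, Submodule.subtype_apply]

lemma exists_facet_faceIdeal_le [Fintype V] {Q : Ideal (MvPolynomial V k)} [Q.IsPrime]
    (hQ : Module.annihilator (MvPolynomial V k)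
      (subquot (dimFiltration k Δ d) (dimFiltration k Δ (d + 1))) ≤ Q) :
    ∃ F, IsFacet Δ F ∧ F.card = d ∧ faceIdeal k F ≤ Q := by
  by_contra! hno
  obtain ⟨s, hsQ, hs⟩ := exists_notMem_forall_mem_faceIdeal Q
  refine hsQ (hQ (Module.mem_annihilator.2 fun z => ?_))
  obtain ⟨m, rfl⟩ := Submodule.Quotient.mk_surjective _ z
  rw [← Submodule.Quotient.mk_smul, mk_subquot_eq_zero_iff, mem_dimFiltration_succ]
  exact ⟨(s • m).2, fun F hF hd => Ideal.mul_mem_right _ _ (hs F (hno F hF hd))⟩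

lemma mDim_localizedModule_layer_le [Fintype V] {p : Ideal (MvPolynomial V k)} [p.IsPrime]
    {n : WithBot ℕ∞}
    (h : ∀ F, IsFacet Δ F → F.card = d → faceIdeal k F ≤ p →
      ringKrullDim (Localization p.primeCompl ⧸
        (faceIdeal k F).map (algebraMap _ (Localization p.primeCompl))) ≤ n) :
    mDim (Localization p.primeCompl) (LocalizedModule p.primeCompl
      (subquot (dimFiltration k Δ d) (dimFiltration k Δ (d + 1)))) ≤ n := by
  refine ringKrullDim_quotient_le fun Q' hQ' hann => ?_
  let Q := Q'.comap (algebraMap (MvPolynomial V k) (Localization p.primeCompl))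
  have hQ : Q.IsPrime := hQ'.comap _
  have hQp : Q ≤ p := by
    have h1 := Ideal.comap_mono (f := algebraMap (MvPolynomial V k) (Localization p.primeCompl))
      (IsLocalRing.le_maximalIdeal hQ'.ne_top)
    exact h1.trans Localization.AtPrime.under_maximalIdeal.le
  obtain ⟨F, hF, hd, hFQ⟩ : ∃ F, IsFacet Δ F ∧ F.card = d ∧ faceIdeal k F ≤ Q := by
    refine exists_facet_faceIdeal_le fun r hr => hann (Module.mem_annihilator.2 fun z => ?_)
    induction z using LocalizedModule.induction_on with
    | h m s =>
      rw [algebraMap_smul, LocalizedModule.smul'_mk, Module.mem_annihilator.1 hr m,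
        LocalizedModule.zero_mk]
  exact ⟨_, Ideal.map_le_iff_le_comap.2 hFQ, h F hF hd (hFQ.trans hQp)⟩

lemma mul_mem_dimFiltration {p : Ideal (MvPolynomial V k)} {s₀ x s m : MvPolynomial V k}
    (hs₀ : ∀ F : Finset V, ¬ faceIdeal k F ≤ p → s₀ ∈ faceIdeal k F)
    (hx : ∀ F, IsFacet Δ F → F.card = d → faceIdeal k F ≤ p → x ∉ faceIdeal k F)
    (hm : m ∈ dimFiltration k Δ (d + 1)) (hs : s ∉ p) (h : s * (x * m) ∈ dimFiltration k Δ d) :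
    s₀ * m ∈ dimFiltration k Δ d := by
  rw [mem_dimFiltration_succ]
  refine ⟨Ideal.mul_mem_left _ _ hm, fun F hF hd => ?_⟩
  by_cases hFp : faceIdeal k F ≤ p
  · have h1 := (mem_dimFiltration_succ.1 h).2 F hF hd
    have h2 := (Ideal.IsPrime.mem_or_mem inferInstance h1).resolve_left fun h => hs (hFp h)
    exact Ideal.mul_mem_left _ _ ((Ideal.IsPrime.mem_or_mem inferInstance h2).resolve_left
      (hx F hF hd hFp))
  · exact Ideal.mul_mem_right _ _ (hs₀ F hFp)

theorem exists_sub_mul_mem_dimFiltration [Fintype V] (hΔ : IsComplex Δ)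
    [DecidableEq V] (hsc : IsStronglyConnected Δ)
    {p : Ideal (MvPolynomial V k)} {s₀ x y s m m' : MvPolynomial V k}
    (hs₀ : ∀ F : Finset V, ¬ faceIdeal k F ≤ p → s₀ ∈ faceIdeal k F) (hxp : x ∈ p)
    (hx : ∀ F, IsFacet Δ F → F.card = d → faceIdeal k F ≤ p →
      x ∉ faceIdeal k F ∧ (faceIdeal k F ⊔ Ideal.span {x}).IsPrime)
    (hy : ∀ F, IsFacet Δ F → F.card = d → faceIdeal k F ≤ p →
      y ∉ faceIdeal k F ⊔ Ideal.span {x})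
    (hm : m ∈ dimFiltration k Δ (d + 1)) (hm' : m' ∈ dimFiltration k Δ (d + 1)) (hs : s ∉ p)
    (h : s * (y * m) - x * m' ∈ dimFiltration k Δ d) :
    ∃ g ∈ dimFiltration k Δ (d + 1), s₀ * m - x * g ∈ dimFiltration k Δ d := by
  have hcoef : ∀ F : Finset V, ∃ a : MvPolynomial V k,
      (IsFacet Δ F → F.card = d → faceIdeal k F ≤ p → m - x * a ∈ faceIdeal k F) ∧
      (¬ (IsFacet Δ F ∧ F.card = d ∧ faceIdeal k F ≤ p) → a = 0) := by
    intro F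
    by_cases hF : IsFacet Δ F ∧ F.card = d ∧ faceIdeal k F ≤ p
    swap
    · exact ⟨0, fun h1 h2 h3 => absurd ⟨h1, h2, h3⟩ hF, fun _ => rfl⟩
    obtain ⟨hF, hd, hFp⟩ := hF
    obtain ⟨hxF, hprime⟩ := hx F hF hd hFp
    have hlep : faceIdeal k F ⊔ Ideal.span {x} ≤ p :=
      sup_le hFp ((Ideal.span_singleton_le_iff_mem _).2 hxp)
    have h1 : s * (y * m) ∈ faceIdeal k F ⊔ Ideal.span {x} := by
      rw [← sub_add_cancel (s * (y * m)) (x * m')]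
      exact add_mem (Ideal.mem_sup_left ((mem_dimFiltration_succ.1 h).2 F hF hd))
        (Ideal.mem_sup_right (Ideal.mul_mem_right _ _ (Ideal.mem_span_singleton_self x)))
    have h2 := (hprime.mem_or_mem h1).resolve_left fun h => hs (hlep h)
    have h3 := (hprime.mem_or_mem h2).resolve_left (hy F hF hd hFp)
    obtain ⟨b, hb, c, hc, hbc⟩ := Submodule.mem_sup.1 h3
    obtain ⟨a, rfl⟩ := Ideal.mem_span_singleton.1 hc
    exact ⟨a, fun _ _ _ => by rwa [← hbc, add_sub_cancel_right], fun h => absurd ⟨hF, hd, hFp⟩ h⟩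
  choose a ha ha₀ using hcoef
  have hnonfacet : ∀ F ∈ Δ, F.card = d → ¬ IsFacet Δ F → ∀ z ∈ dimFiltration k Δ (d + 1),
      z ∈ faceIdeal k F := by
    intro F hF hd hnf z hz
    obtain ⟨G, hG, hFG⟩ := exists_facet_superset hF
    have hlt : F.card < G.card := Finset.card_lt_card
      (hFG.ssubset_of_ne fun h => hnf (h ▸ hG))
    exact faceIdeal_le_iff.2 hFG (mem_dimFiltration.1 hz G hG (by omega))
  have hxa : ∀ F ∈ Δ, F.card = d → faceIdeal k F ≤ p → m - x * a F ∈ faceIdeal k F := by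
    intro F hF hd hFp
    by_cases hfac : IsFacet Δ F
    · exact ha F hfac hd hFp
    · rw [ha₀ F fun h => hfac h.1, mul_zero, sub_zero]
      exact hnonfacet F hF hd hfac m hm
  have hya : ∀ F ∈ Δ, F.card = d → faceIdeal k F ≤ p → s * (y * a F) - m' ∈ faceIdeal k F := by
    intro F hF hd hFp
    by_cases hfac : IsFacet Δ F
    · have h1 : x * (s * (y * a F) - m') ∈ faceIdeal k F := by
        have h2 := sub_mem ((mem_dimFiltration_succ.1 h).2 F hfac hd)
          (Ideal.mul_mem_left _ (s * y) (ha F hfac hd hFp))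
        convert h2 using 1
        ring
      exact (Ideal.IsPrime.mem_or_mem inferInstance h1).resolve_left (hx F hfac hd hFp).1
    · rw [ha₀ F fun h => hfac h.1, mul_zero, mul_zero, zero_sub]
      exact neg_mem (hnonfacet F hF hd hfac m' hm')
  have hcompat : ∀ F ∈ Δ, ∀ F' ∈ Δ, F.card = d → F'.card = d → ∀ i ∈ F, ∀ j ∉ F,
      F' = insert j (F.erase i) → s₀ * a F - s₀ * a F' ∈ faceIdeal k (F.erase i) := by
    intro F hF F' hF' hd hd' i hi j hj hFF'
    rw [← mul_sub]
    by_cases hEp : faceIdeal k (F.erase i) ≤ p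
    swap
    · exact Ideal.mul_mem_right _ _ (hs₀ _ hEp)
    refine Ideal.mul_mem_left _ _ ?_
    have hjE : j ∉ F.erase i := fun h => hj (Finset.mem_of_mem_erase h)
    have hE' : F'.erase j = F.erase i := by rw [hFF', Finset.erase_insert hjE]
    have hle : faceIdeal k F ≤ faceIdeal k (F.erase i) :=
      faceIdeal_le_iff.2 (Finset.erase_subset _ _)
    have hle' : faceIdeal k F' ≤ faceIdeal k (F.erase i) :=
      faceIdeal_le_iff.2 (hE' ▸ Finset.erase_subset _ _)
    have hX : x * (a F - a F') ∈ faceIdeal k (F.erase i) := by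
      convert sub_mem (hle' (hxa F' hF' hd' (hle'.trans hEp))) (hle (hxa F hF hd (hle.trans hEp)))
        using 1
      ring
    have hY : s * (y * (a F - a F')) ∈ faceIdeal k (F.erase i) := by
      convert sub_mem (hle (hya F hF hd (hle.trans hEp))) (hle' (hya F' hF' hd' (hle'.trans hEp)))
        using 1
      ring
    replace hY := (Ideal.IsPrime.mem_or_mem inferInstance hY).resolve_left fun h => hs (hEp h)
    rcases Ideal.IsPrime.mem_or_mem inferInstance hX with hxE | hres
    swap
    · exact hres
    rcases Ideal.IsPrime.mem_or_mem inferInstance hY with hyE | hres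
    swap
    · exact hres
    by_cases hfac : IsFacet Δ F
    · obtain ⟨h1, h2⟩ := hx F hfac hd (hle.trans hEp)
      exact absurd hyE (notMem_faceIdeal_erase h1 h2 (hy F hfac hd (hle.trans hEp)) hxE)
    by_cases hfac' : IsFacet Δ F'
    · obtain ⟨h1, h2⟩ := hx F' hfac' hd' (hle'.trans hEp)
      rw [← hE'] at hxE hyE
      exact absurd hyE (notMem_faceIdeal_erase h1 h2 (hy F' hfac' hd' (hle'.trans hEp)) hxE)
    · rw [ha₀ F fun h => hfac h.1, ha₀ F' fun h => hfac' h.1, sub_zero]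
      exact zero_mem _
  obtain ⟨g, hg, hga⟩ := exists_glue (d := d) hΔ hsc (fun F => s₀ * a F)
    (fun F _ _ hF => by simp [ha₀ F fun h => hF h.1]) hcompat
  refine ⟨g, hg, mem_dimFiltration_succ.2
    ⟨sub_mem (Ideal.mul_mem_left _ _ hm) (Ideal.mul_mem_left _ _ hg), fun F hF hd => ?_⟩⟩
  have h1 := hga F hF.1 hd
  have h2 : s₀ * (m - x * a F) ∈ faceIdeal k F := by
    by_cases hFp : faceIdeal k F ≤ p
    · exact Ideal.mul_mem_left _ _ (ha F hF hd hFp)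
    · exact Ideal.mul_mem_right _ _ (hs₀ F hFp)
  convert sub_mem h2 (Ideal.mul_mem_left _ x h1) using 1
  ring

theorem isSerreMod_two_layer [Fintype V] (hΔ : IsComplex Δ) [DecidableEq V]
    (hsc : IsStronglyConnected Δ) :
    IsSerreMod 2 (MvPolynomial V k)
      (subquot (dimFiltration k Δ d) (dimFiltration k Δ (d + 1))) := by
  intro p hp
  rcases subsingleton_or_nontrivial (LocalizedModule p.primeCompl
    (subquot (dimFiltration k Δ d) (dimFiltration k Δ (d + 1)))) with hM | hM
  · refine (min_le_right _ _).trans ?_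
    rw [mDim, Module.annihilator_eq_top_iff.2 hM, ringKrullDim_eq_bot_of_subsingleton]
    exact bot_le
  by_cases hmin : ∃ F, IsFacet Δ F ∧ F.card = d ∧ faceIdeal k F = p
  · obtain ⟨F, hF, hd, hFp⟩ := hmin
    have hdim := mDim_localizedModule_layer_le (k := k) (Δ := Δ) (d := d) (p := p) (n := 0) ?_
    · exact (min_le_right _ _).trans (hdim.trans (by exact_mod_cast bot_le))
    · intro F' hF' hd' hFp'
      have hEq : F = F' := Finset.eq_of_subset_of_card_le
        (faceIdeal_le_iff.1 (hFp'.trans hFp.ge)) (by omega)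
      simpa using ringKrullDim_localization_quotient_le (p := p) (K := faceIdeal k F')
        Set.finite_empty (by simp [← hFp, hEq])
  obtain ⟨s₀, hs₀p, hs₀⟩ := exists_notMem_forall_mem_faceIdeal p
  obtain ⟨x, hxp, hx, hxy⟩ := exists_general_elements (p := p) (d := d)
    (S := {F | IsFacet Δ F ∧ F.card = d ∧ faceIdeal k F ≤ p}) (fun F hF => hF.2.1)
    (fun F hF => hF.2.2) (fun F hF h => hmin ⟨F, hF.1, hF.2.1, h⟩)
  have hregx : IsSMulRegular (LocalizedModule p.primeCompl
      (subquot (dimFiltration k Δ d) (dimFiltration k Δ (d + 1))))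
      (algebraMap _ (Localization p.primeCompl) x) := by
    refine isSMulRegular_localizedModule fun z s hs hz => ⟨s₀, hs₀p, ?_⟩
    obtain ⟨m, rfl⟩ := Submodule.Quotient.mk_surjective _ z
    rw [← Submodule.Quotient.mk_smul, ← Submodule.Quotient.mk_smul,
      mk_subquot_eq_zero_iff] at hz
    rw [← Submodule.Quotient.mk_smul, mk_subquot_eq_zero_iff]
    exact mul_mem_dimFiltration hs₀ (fun F hF hd hFp => (hx F ⟨hF, hd, hFp⟩).1) m.2 hs hz
  rcases hxy with ⟨y, hyp, hy⟩ | hpx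
  · refine (min_le_left _ _).trans ?_
    have hregy : IsSMulRegular (QuotSMulTop (algebraMap _ (Localization p.primeCompl) x)
        (LocalizedModule p.primeCompl
          (subquot (dimFiltration k Δ d) (dimFiltration k Δ (d + 1)))))
        (algebraMap _ (Localization p.primeCompl) y) := by
      refine isSMulRegular_quotSMulTop_localizedModule fun z z' s hs hz => ?_
      obtain ⟨m, rfl⟩ := Submodule.Quotient.mk_surjective _ z
      obtain ⟨m', rfl⟩ := Submodule.Quotient.mk_surjective _ z'
      rw [← Submodule.Quotient.mk_smul, ← Submodule.Quotient.mk_smul,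
        ← Submodule.Quotient.mk_smul, ← sub_eq_zero, ← Submodule.Quotient.mk_sub,
        mk_subquot_eq_zero_iff] at hz
      obtain ⟨g, hg, hgm⟩ := exists_sub_mul_mem_dimFiltration hΔ hsc hs₀ hxp
        (fun F hF hd hFp => hx F ⟨hF, hd, hFp⟩) (fun F hF hd hFp => hy F ⟨hF, hd, hFp⟩)
        m.2 m'.2 hs hz
      refine ⟨s₀, hs₀p, Submodule.Quotient.mk ⟨g, hg⟩, ?_⟩
      rw [← Submodule.Quotient.mk_smul, ← Submodule.Quotient.mk_smul, ← sub_eq_zero,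
        ← Submodule.Quotient.mk_sub, mk_subquot_eq_zero_iff]
      exact hgm
    have := le_depthIn_localizedModule (p := p) (rs := [x, y])
      (M := subquot (dimFiltration k Δ d) (dimFiltration k Δ (d + 1))) (by simp [hxp, hyp])
      (by simpa [RingTheory.Sequence.isWeaklyRegular_cons_iff] using ⟨hregx, hregy⟩)
    exact WithBot.coe_le_coe.2 this
  · have hdim := mDim_localizedModule_layer_le (k := k) (Δ := Δ) (d := d) (p := p) (n := 1) ?_
    · refine (min_le_right _ _).trans (hdim.trans ?_)
      have := le_depthIn_localizedModule (p := p) (rs := [x])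
        (M := subquot (dimFiltration k Δ d) (dimFiltration k Δ (d + 1))) (by simp [hxp])
        (by simpa [RingTheory.Sequence.isWeaklyRegular_cons_iff] using hregx)
      exact WithBot.coe_le_coe.2 this
    · intro F hF hd hFp
      simpa using ringKrullDim_localization_quotient_le (p := p) (K := faceIdeal k F)
        (Set.finite_singleton x) (hpx F ⟨hF, hd, hFp⟩)

end Layers

/-! ### The sequential filtration -/

section Filtration

variable {V : Type*} {k : Type*} [Field k] {Δ : Set (Finset V)} {d : ℕ}

theorem mDim_layer [Fintype V]
    (h : dimFiltration k Δ d ≠ dimFiltration k Δ (d + 1)) :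
    mDim (MvPolynomial V k) (subquot (dimFiltration k Δ d) (dimFiltration k Δ (d + 1))) = d := by
  apply le_antisymm
  · refine ringKrullDim_quotient_le fun Q hQ hann => ?_
    obtain ⟨F, -, hd, hFQ⟩ := exists_facet_faceIdeal_le hann
    exact ⟨_, hFQ, by rw [ringKrullDim_quotient_faceIdeal, hd]⟩
  · obtain ⟨F, hF, hd⟩ := exists_facet_of_dimFiltration_ne h
    have hle : Module.annihilator (MvPolynomial V k)
        (subquot (dimFiltration k Δ d) (dimFiltration k Δ (d + 1))) ≤ faceIdeal k F := by
      intro r hr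
      have hprod : (∏ i ∈ F, X i : MvPolynomial V k) ∈ dimFiltration k Δ (d + 1) := by
        rw [mem_dimFiltration]
        intro G hG hdG
        rw [prod_X_mem_faceIdeal]
        intro hFG
        rw [← hF.2 G hG.1 hFG] at hdG
        omega
      have h1 := Module.mem_annihilator.1 hr (Submodule.Quotient.mk ⟨_, hprod⟩)
      rw [← Submodule.Quotient.mk_smul, mk_subquot_eq_zero_iff] at h1
      exact (Ideal.IsPrime.mem_or_mem inferInstance
        ((mem_dimFiltration_succ.1 h1).2 F hF hd)).resolve_right fun h =>
          prod_X_mem_faceIdeal.1 h subset_rfl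
    have hdim : (d : WithBot ℕ∞) = ringKrullDim (MvPolynomial V k ⧸ faceIdeal k F) := by
      rw [ringKrullDim_quotient_faceIdeal, hd]
    rw [hdim]
    exact ringKrullDim_le_of_surjective (Ideal.Quotient.factor hle)
      (Ideal.Quotient.factor_surjective hle)

lemma exists_strict_subsequence {α : Type*} [PartialOrder α] {I : ℕ → α}
    (hI : ∀ n, I n ≤ I (n + 1)) (N : ℕ) :
    ∃ (t : ℕ) (J : ℕ → α) (D : ℕ → ℕ), J 0 = I 0 ∧ J t = I N ∧ (∀ i, ∃ e, J i = I e) ∧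
      (∀ i < t, D i < N ∧ J i = I (D i) ∧ J (i + 1) = I (D i + 1) ∧ J i < J (i + 1)) ∧
      ∀ i, i + 2 ≤ t → D i < D (i + 1) := by
  induction N with
  | zero => exact ⟨0, fun _ => I 0, fun _ => 0, rfl, rfl, fun _ => ⟨0, rfl⟩, by simp, by simp⟩
  | succ N ih =>
    obtain ⟨t, J, D, h0, ht, hJ, hstep, hD⟩ := ih
    by_cases hN : I N = I (N + 1)
    · exact ⟨t, J, D, h0, ht.trans hN, hJ,
        fun i hi => ⟨(hstep i hi).1.trans (Nat.lt_succ_self N), (hstep i hi).2⟩, hD⟩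
    refine ⟨t + 1, fun i => if i ≤ t then J i else I (N + 1), fun i => if i < t then D i else N,
      by simpa using h0, by simp, fun i => ?_, fun i hi => ?_, fun i hi => ?_⟩
    · by_cases hi : i ≤ t
      · simpa [hi] using hJ i
      · exact ⟨N + 1, by simp [hi]⟩
    · rcases (Nat.lt_succ_iff.1 hi).lt_or_eq with hit | rfl
      · obtain ⟨h1, h2⟩ := hstep i hit
        simpa [hit, hit.le, Nat.succ_le_of_lt hit] using ⟨h1.le, h2⟩
      · simpa [ht] using lt_of_le_of_ne (hI N) hN
    · have hit : i < t := by omega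
      rcases Nat.lt_or_ge (i + 1) t with h | h
      · simpa [hit, h] using hD i h
      · simpa [hit, h.not_gt] using (hstep i hit).1

theorem isSeqSerre_two_of_isStronglyConnected [Fintype V] [DecidableEq V] (hΔ : IsComplex Δ)
    (hsc : IsStronglyConnected Δ) : IsSeqSerre k Δ 2 := by
  obtain ⟨t, J, D, h0, ht, hJ, hstep, hD⟩ := exists_strict_subsequence
    (I := dimFiltration k Δ) (fun _ => dimFiltration_le_succ) (Fintype.card V + 1)
  have hdim : ∀ i < t, mDim (MvPolynomial V k) (subquot (J i) (J (i + 1))) = D i := by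
    intro i hi
    obtain ⟨-, h1, h2, hlt⟩ := hstep i hi
    rw [h1, h2] at hlt ⊢
    exact mDim_layer hlt.ne
  refine ⟨t, J, h0.trans (dimFiltration_zero hΔ), ht.trans (dimFiltration_eq_top fun F _ =>
    Nat.lt_succ_of_le F.card_le_univ), fun i _ => ?_, fun i hi => (hstep i hi).2.2.2,
    fun i hi => ?_, fun i hi => ?_⟩
  · obtain ⟨e, he⟩ := hJ i
    exact he ▸ isHomogeneousIdeal_dimFiltration
  · obtain ⟨-, h1, h2, -⟩ := hstep i hi
    rw [h1, h2]
    exact isSerreMod_two_layer hΔ hsc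
  · rw [hdim i (by omega), hdim (i + 1) (by omega)]
    exact_mod_cast hD i hi

end Filtration

/-- **Graphs with no chordless even cycle are sequentially `S_2`.**
If `G` is a finite simple graph with no chordless even cycle, then `G` is
sequentially `S_2` over any field `k`. -/
theorem isSeqSerre_two_of_no_chordless_even_cycle (k : Type*) [Field k]
    (V : Type*) [Fintype V] (G : SimpleGraph V)
    (h : ∀ m : ℕ, Even m → ¬ HasChordlessCycle G m) :
    IsSeqSerre k (indepComplex G) 2 := by
  classical
  exact isSeqSerre_two_of_isStronglyConnected
    (fun _ hF _ hGF x hx y hy => hF x (hGF hx) y (hGF hy))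
    (isStronglyConnected_indepComplex h)

end SeqSr
end
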